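/- arXiv:2210.12577 — 3 statements merged into one kernel-verified Lean document; each statement's English description precedes it below -/
import Mathlib

section
/- For every non-trivial graph G, the tree-partition-width of G satisfies tpw(G) ≤ 24·(tw(G)+1)·Δ(G). -/
open SimpleGraph

/-- The maximum degree of a finite simple graph `G`:
the supremum of the numbers of neighbours of its vertices. -/
noncomputable def maxDeg {V : Type*} [Fintype V] (G : SimpleGraph V) : ℕ :=
  sSup (Set.range fun v => (G.neighborSet v).ncard)

/-- `B` is a `T`-partition of the graph `G`: the tree `T` indexes a partition
`(B x : x ∈ V(T))` of `V(G)` such that for every edge `vw` of `G`, if `v ∈ B x` and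
`w ∈ B y` then `x = y` or `xy ∈ E(T)`. -/
structure IsTreePartition {V ι : Type*} (G : SimpleGraph V) (T : SimpleGraph ι)
    (B : ι → Set V) : Prop where
  /-- `T` is a tree. -/
  isTree : T.IsTree
  /-- the parts are nonempty -/
  part_nonempty : ∀ x, (B x).Nonempty
  /-- every vertex of `G` lies in exactly one part -/
  part_existsUnique : ∀ v, ∃! x, v ∈ B x
  /-- parts containing adjacent vertices are equal or adjacent in `T` -/
  part_adj : ∀ ⦃v w x y⦄, G.Adj v w → v ∈ B x → w ∈ B y → x = y ∨ T.Adj x y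

/-- `B` is a tree-decomposition of the graph `G` over the tree `T`:
every edge of `G` has both ends in a common bag, and for each vertex `v` of `G`
the set of nodes whose bag contains `v` induces a non-empty subtree of `T`. -/
structure IsTreeDecomp {V ι : Type*} (G : SimpleGraph V) (T : SimpleGraph ι)
    (B : ι → Set V) : Prop where
  /-- `T` is a tree. -/
  isTree : T.IsTree
  /-- every edge of `G` lies in some bag -/
  edge_mem : ∀ ⦃u v⦄, G.Adj u v → ∃ x, u ∈ B x ∧ v ∈ B x
  /-- the bags containing a given vertex induce a non-empty subtree -/
  subtree : ∀ v, (T.induce {x | v ∈ B x}).Connected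

/-- The treewidth of a finite graph: the minimum, over tree-decompositions,
of the maximum bag size minus one. -/
noncomputable def treewidth {V : Type} [Fintype V] (G : SimpleGraph V) : ℕ :=
  sInf {k | ∃ (ι : Type) (_ : Fintype ι) (T : SimpleGraph ι) (B : ι → Set V),
    IsTreeDecomp G T B ∧ ∀ x, (B x).ncard ≤ k + 1}

/-- The tree-partition-width of a finite graph: the minimum width of a tree-partition. -/
noncomputable def tpw {V : Type} [Fintype V] (G : SimpleGraph V) : ℕ :=
  sInf {k | ∃ (ι : Type) (_ : Fintype ι) (T : SimpleGraph ι) (B : ι → Set V),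
    IsTreePartition G T B ∧ ∀ x, (B x).ncard ≤ k}

/-- The nodes `x` and `y` are joined by a walk of `T` that avoids `t`. -/
def AvoidReach {ι : Type*} (T : SimpleGraph ι) (t x y : ι) : Prop :=
  ∃ p : T.Walk x y, t ∉ p.support

namespace AvoidReach

variable {ι : Type*} {T : SimpleGraph ι} {t x y z : ι}

lemma refl (h : x ≠ t) : AvoidReach T t x x := ⟨.nil, by simpa using h.symm⟩

lemma symm : AvoidReach T t x y → AvoidReach T t y x := by
  rintro ⟨p, hp⟩
  exact ⟨p.reverse, by simpa using hp⟩

lemma trans : AvoidReach T t x y → AvoidReach T t y z → AvoidReach T t x z := by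
  rintro ⟨p, hp⟩ ⟨q, hq⟩
  exact ⟨p.append q, by simp [Walk.mem_support_append_iff, hp, hq]⟩

lemma left_ne : AvoidReach T t x y → x ≠ t := by
  rintro ⟨p, hp⟩ rfl
  exact hp p.start_mem_support

lemma exists_adj (hT : T.Connected) (h : x ≠ t) : ∃ u, T.Adj t u ∧ AvoidReach T t x u := by
  obtain ⟨p, hp⟩ := hT.exists_isPath t x
  cases p with
  | nil => exact absurd rfl h
  | cons hu q => exact ⟨_, hu, symm ⟨q, ((Walk.cons_isPath_iff _ _).1 hp).2⟩⟩

/-- In a tree, the two sides of an edge are disjoint. -/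
lemma not_both (hT : T.IsTree) {u : ι} (htu : T.Adj t u) (h₁ : AvoidReach T t y u)
    (h₂ : AvoidReach T u y t) : False := by
  obtain ⟨p, hp⟩ := h₁
  obtain ⟨q, hq⟩ := h₂
  have hb := isBridge_iff_forall_walk_mem_edges.1
    (isAcyclic_iff_forall_adj_isBridge.1 hT.isAcyclic htu) (q.reverse.append p)
  simp only [Walk.edges_append, Walk.edges_reverse, List.mem_append, List.mem_reverse] at hb
  rcases hb with hb | hb
  · exact hq (q.snd_mem_support_of_mem_edges hb)
  · exact hp (p.fst_mem_support_of_mem_edges hb)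

lemma or_of_ne (hT : T.Connected) {u : ι} (hut : u ≠ t) :
    AvoidReach T u x t ∨ AvoidReach T t x u := by
  classical
  obtain ⟨p, hp⟩ := hT.exists_isPath x u
  by_cases h : t ∈ p.support
  · exact Or.inl ⟨p.takeUntil t h, Walk.endpoint_notMem_support_takeUntil hp h hut⟩
  · exact Or.inr ⟨p, h⟩

end AvoidReach

namespace IsTreeDecomp

variable {V ι : Type*} {G : SimpleGraph V} {T : SimpleGraph ι} {B : ι → Set V}

lemma avoidReach (h : IsTreeDecomp G T B) {v : V} {t x y : ι} (ht : v ∉ B t) (hx : v ∈ B x)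
    (hy : v ∈ B y) : AvoidReach T t x y := by
  obtain ⟨p⟩ := (h.subtree v).preconnected ⟨x, hx⟩ ⟨y, hy⟩
  refine ⟨p.map (Embedding.induce _).toHom, fun hm => ?_⟩
  obtain ⟨a, -, rfl⟩ := List.mem_map.1
    ((congrArg (t ∈ ·) (Walk.support_map (Embedding.induce _).toHom p)).mp hm)
  exact ht a.2

lemma exists_mem (h : IsTreeDecomp G T B) (v : V) : ∃ x, v ∈ B x := by
  obtain ⟨⟨x, hx⟩⟩ := (h.subtree v).nonempty
  exact ⟨x, hx⟩

open Classical in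
/-- Some bag leaves at most half of `S` on each of its sides. -/
lemma exists_centroid [Fintype ι] (h : IsTreeDecomp G T B) (S : Finset V) :
    ∃ t, ∀ x, 2 * (S.filter fun v => ∀ y, v ∈ B y → AvoidReach T t y x).card ≤ S.card := by
  by_contra! hcon
  choose f hf using hcon
  obtain ⟨a₀⟩ := h.isTree.connected.nonempty
  obtain ⟨⟨t, x⟩, hm, hmin⟩ := Finset.exists_min_image
    ((Finset.univ : Finset (ι × ι)).filter fun a : ι × ι =>
      S.card < 2 * (S.filter fun v => ∀ y, v ∈ B y → AvoidReach T a.1 y a.2).card)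
    (fun a : ι × ι => (Finset.univ.filter fun y => AvoidReach T a.1 y a.2).card)
    ⟨(a₀, f a₀), by simpa using hf a₀⟩
  simp only [Finset.mem_filter, Finset.mem_univ, true_and] at hm hmin
  have hxt : x ≠ t := by
    rintro rfl
    have : (S.filter fun v => ∀ y, v ∈ B y → AvoidReach T x y x).card = 0 := by
      rw [Finset.card_eq_zero, Finset.filter_eq_empty_iff]
      intro v _ hv
      obtain ⟨y, hy⟩ := h.exists_mem v
      exact (hv y hy).symm.left_ne rfl
    omega
  obtain ⟨u, htu, hxu⟩ := AvoidReach.exists_adj h.isTree.connected hxt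
  have hu := hf u
  by_cases hc : AvoidReach T u (f u) t
  · have hd : Disjoint (S.filter fun v => ∀ y, v ∈ B y → AvoidReach T t y x)
        (S.filter fun v => ∀ y, v ∈ B y → AvoidReach T u y (f u)) := by
      rw [Finset.disjoint_filter]
      intro v _ h₁ h₂
      obtain ⟨y, hy⟩ := h.exists_mem v
      exact AvoidReach.not_both h.isTree htu ((h₁ y hy).trans hxu) ((h₂ y hy).trans hc)
    have hle := Finset.card_le_card (Finset.union_subset
      (Finset.filter_subset (fun v => ∀ y, v ∈ B y → AvoidReach T t y x) S)
      (Finset.filter_subset (fun v => ∀ y, v ∈ B y → AvoidReach T u y (f u)) S))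
    rw [Finset.card_union_of_disjoint hd] at hle
    omega
  · refine absurd (hmin (u, f u) hu) (not_le.2 (Finset.card_lt_card ?_))
    rw [Finset.ssubset_iff_of_subset]
    · exact ⟨u, by simpa using hxu.symm, by simpa using fun hh => hh.left_ne rfl⟩
    · intro y hy
      simp only [Finset.mem_filter, Finset.mem_univ, true_and] at hy ⊢
      rcases AvoidReach.or_of_ne (x := y) h.isTree.connected htu.ne' with h' | h'
      · exact absurd (hy.symm.trans h') hc
      · exact h'.trans hxu.symm

open Classical in
/-- Balanced separations with respect to a set `S`. -/
lemma exists_separation [Fintype V] [Fintype ι] (h : IsTreeDecomp G T B) (S : Finset V) :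
    ∃ t, ∃ A : Finset V, (∀ v ∈ A, v ∉ B t) ∧
      (∀ v ∈ A, ∀ w, G.Adj v w → w ∉ B t → w ∈ A) ∧
      3 * (S ∩ A).card ≤ 2 * S.card ∧
      3 * (S.filter fun v => v ∉ B t ∧ v ∉ A).card ≤ 2 * S.card := by
  obtain ⟨t, ht⟩ := h.exists_centroid S
  obtain ⟨A, hA, hmax⟩ := Finset.exists_max_image
    ((Finset.univ : Finset (Finset V)).filter fun A => (∀ v ∈ A, v ∉ B t) ∧
      (∀ v ∈ A, ∀ w, G.Adj v w → w ∉ B t → w ∈ A) ∧ 3 * (S ∩ A).card ≤ 2 * S.card)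
    (fun A => (S ∩ A).card) ⟨∅, by simp⟩
  simp only [Finset.mem_filter, Finset.mem_univ, true_and] at hA hmax
  obtain ⟨hA₁, hA₂, hA₃⟩ := hA
  refine ⟨t, A, hA₁, hA₂, hA₃, ?_⟩
  by_contra! hlt
  obtain ⟨v, hv⟩ : (S.filter fun v => v ∉ B t ∧ v ∉ A).Nonempty := by
    rw [← Finset.card_pos]; omega
  simp only [Finset.mem_filter] at hv
  obtain ⟨hvS, hvt, hvA⟩ := hv
  obtain ⟨x, hx⟩ := h.exists_mem v
  set C : Finset V := Finset.univ.filter fun v => ∀ y, v ∈ B y → AvoidReach T t y x with hC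
  have hvC : v ∈ C := by simpa [hC] using fun y hy => h.avoidReach hvt hy hx
  have hC₁ : ∀ v ∈ C, v ∉ B t := by
    intro v hv hvt
    simp only [hC, Finset.mem_filter, Finset.mem_univ, true_and] at hv
    exact (hv t hvt).left_ne rfl
  have hC₂ : ∀ v ∈ C, ∀ w, G.Adj v w → w ∉ B t → w ∈ C := by
    intro v hv w hvw hw
    simp only [hC, Finset.mem_filter, Finset.mem_univ, true_and] at hv ⊢
    obtain ⟨y, hy₁, hy₂⟩ := h.edge_mem hvw
    exact fun z hz => (h.avoidReach hw hz hy₂).trans (hv y hy₁)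
  have hC₃ : 2 * (S ∩ C).card ≤ S.card := by
    convert ht x using 3
    ext; simp [hC]
  have hCm := hmax C ⟨hC₁, hC₂, by omega⟩
  have hsub : (S ∩ (A ∪ C)).card ≤ (S ∩ A).card + (S ∩ C).card := by
    rw [Finset.inter_union_distrib_left]
    exact Finset.card_union_le _ _
  have hAC : (S ∩ A).card < (S ∩ (A ∪ C)).card := by
    apply Finset.card_lt_card
    rw [Finset.ssubset_iff_of_subset (by gcongr; exact Finset.subset_union_left)]
    exact ⟨v, by simp [hvS, hvC], by simp [hvA]⟩
  have hdis : (S.filter fun v => v ∉ B t ∧ v ∉ A).card + (S ∩ A).card ≤ S.card := by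
    rw [← Finset.card_union_of_disjoint]
    · exact Finset.card_le_card (by intro; simp; tauto)
    · rw [Finset.disjoint_left]; intro; simp; tauto
  by_cases hbig : 3 * (S ∩ (A ∪ C)).card ≤ 2 * S.card
  · refine absurd (hmax (A ∪ C) ⟨?_, ?_, hbig⟩) (not_le.2 hAC)
    · intro v hv
      rcases Finset.mem_union.1 hv with hv | hv
      exacts [hA₁ v hv, hC₁ v hv]
    · intro v hv w hvw hw
      rcases Finset.mem_union.1 hv with hv | hv
      exacts [Finset.mem_union_left _ (hA₂ v hv w hvw hw),
        Finset.mem_union_right _ (hC₂ v hv w hvw hw)]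
  · omega

end IsTreeDecomp

/-- A parent function `p` fixing only the root `r` (as witnessed by `depth`) defines a tree. -/
lemma isTree_fromRel_parent {ι : Type*} [Fintype ι] {p : ι → ι} {depth : ι → ℕ} {r : ι}
    (hd : ∀ i, i ≠ r → depth (p i) < depth i) (hr : p r = r) :
    (SimpleGraph.fromRel fun i j => p i = j).IsTree := by
  classical
  set T := SimpleGraph.fromRel fun i j => p i = j with hT
  have hreach : ∀ n i, depth i ≤ n → T.Reachable i r := by
    intro n
    induction n with
    | zero =>
      intro i hi
      by_cases h : i = r
      · exact h ▸ Reachable.refl _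
      · exact absurd (hd i h) (by omega)
    | succ n ih =>
      intro i hi
      by_cases h : i = r
      · exact h ▸ Reachable.refl _
      · have := hd i h
        have hadj : T.Adj i (p i) := by
          rw [hT, fromRel_adj]
          exact ⟨fun e => by rw [← e] at this; exact lt_irrefl _ this, Or.inl rfl⟩
        exact hadj.reachable.trans (ih _ (by omega))
  have hcon : T.Connected :=
    { preconnected := fun i j => (hreach _ i le_rfl).trans (hreach _ j le_rfl).symm
      nonempty := ⟨r⟩ }
  refine isTree_iff_connected_and_card.2
    ⟨hcon, le_antisymm ?_ hcon.card_vert_le_card_edgeSet_add_one⟩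
  have hsub : T.edgeSet ⊆ ((Finset.univ.erase r).image fun i => s(i, p i) : Finset (Sym2 ι)) := by
    intro e
    induction e using Sym2.ind with
    | _ i j =>
      intro he
      rw [mem_edgeSet, hT, fromRel_adj] at he
      obtain ⟨hne, he⟩ := he
      simp only [Finset.coe_image, Set.mem_image, Finset.mem_coe, Finset.mem_erase]
      rcases he with rfl | rfl
      · exact ⟨i, ⟨fun h => hne (by rw [h, hr]), Finset.mem_univ _⟩, rfl⟩
      · exact ⟨j, ⟨fun h => hne (by rw [h, hr]), Finset.mem_univ _⟩, Sym2.eq_swap⟩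
  have hle := Set.ncard_le_ncard hsub (Finset.finite_toSet _)
  rw [Set.ncard_coe_finset] at hle
  have hle' := hle.trans Finset.card_image_le
  rw [Finset.card_erase_of_mem (Finset.mem_univ _), Finset.card_univ] at hle'
  have hpos : 0 < Fintype.card ι := Fintype.card_pos_iff.2 ⟨r⟩
  rw [Nat.card_coe_set_eq, Nat.card_eq_fintype_card]
  omega

/-- A tree-partition of `G[W]` of width at most `N`, whose tree is rooted at `r` and described by
the parent function `p`, and whose root part is `R`. -/
structure IsRootedPartition {V ι : Type*} (G : SimpleGraph V) (N : ℕ) (W R : Finset V)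
    (p : ι → ι) (depth : ι → ℕ) (r : ι) (lab : V → ι) : Prop where
  parent_root : p r = r
  depth_parent : ∀ i, i ≠ r → depth (p i) < depth i
  root_subset : R ⊆ W
  lab_eq_root : ∀ v ∈ W, lab v = r ↔ v ∈ R
  exists_lab : ∀ i, ∃ v ∈ W, lab v = i
  card_le : ∀ i, ∀ F ⊆ W, (∀ v ∈ F, lab v = i) → F.card ≤ N
  lab_adj : ∀ v ∈ W, ∀ w ∈ W, G.Adj v w →
    lab v = lab w ∨ p (lab v) = lab w ∨ p (lab w) = lab v

/-- `G[W]` has a rooted tree-partition of width at most `N` with root part `R`. -/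
def HasRootedPartition {V : Type} (G : SimpleGraph V) (N : ℕ) (W R : Finset V) : Prop :=
  ∃ (ι : Type) (_ : Fintype ι) (p : ι → ι) (depth : ι → ℕ) (r : ι) (lab : V → ι),
    IsRootedPartition G N W R p depth r lab

namespace HasRootedPartition

variable {V : Type} {G : SimpleGraph V} {N : ℕ}

lemma single {R : Finset V} (hR : R.Nonempty) (hN : R.card ≤ N) :
    HasRootedPartition G N R R := by
  obtain ⟨v, hv⟩ := hR
  exact ⟨Unit, inferInstance, id, fun _ => 0, (), fun _ => (),
    { parent_root := rfl
      depth_parent := fun i hi => absurd rfl hi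
      root_subset := subset_rfl
      lab_eq_root := by simp
      exists_lab := fun _ => ⟨v, hv, rfl⟩
      card_le := fun _ _ hF _ => (Finset.card_le_card hF).trans hN
      lab_adj := by simp }⟩

open Classical in
/-- Add a new root part `S` above the old root part `R`. -/
lemma cons {W R S : Finset V} (h : HasRootedPartition G N W R) (hS : S.Nonempty)
    (hN : S.card ≤ N) (hd : Disjoint S W) (hadj : ∀ v ∈ S, ∀ w ∈ W, G.Adj v w → w ∈ R) :
    HasRootedPartition G N (S ∪ W) S := by
  obtain ⟨ι, _, p, depth, r, lab, h⟩ := h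
  have hnot : ∀ v ∈ W, v ∉ S := fun v hv hs => Finset.disjoint_left.1 hd hs hv
  refine ⟨Option ι, inferInstance,
    fun o => o.elim none fun i => if i = r then none else some (p i),
    fun o => o.elim 0 fun i => depth i + 1, none,
    fun v => if v ∈ S then none else some (lab v), ?_⟩
  constructor
  · rfl
  · rintro (_ | i) hi
    · exact absurd rfl hi
    · by_cases hr : i = r
      · simp [hr]
      · simpa [hr] using h.depth_parent i hr
  · exact Finset.subset_union_left
  · intro v _
    by_cases hv : v ∈ S <;> simp [hv]
  · rintro (_ | i)
    · obtain ⟨v, hv⟩ := hS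
      exact ⟨v, by simp [hv], by simp [hv]⟩
    · obtain ⟨v, hv, rfl⟩ := h.exists_lab i
      exact ⟨v, by simp [hv], by simp [hnot v hv]⟩
  · rintro (_ | i) F hFW hF
    · refine (Finset.card_le_card fun v hv => ?_).trans hN
      simpa using hF v hv
    · have key : ∀ v ∈ F, v ∉ S ∧ lab v = i := fun v hv => by simpa using hF v hv
      exact h.card_le i F (fun v hv => (Finset.mem_union.1 (hFW hv)).resolve_left (key v hv).1)
        fun v hv => (key v hv).2
  · have key : ∀ v ∈ S, ∀ w ∈ W, G.Adj v w → lab w = r :=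
      fun v hv w hw hvw => (h.lab_eq_root w hw).2 (hadj v hv w hw hvw)
    intro v hv w hw hvw
    by_cases hvS : v ∈ S <;> by_cases hwS : w ∈ S
    · simp [hvS, hwS]
    · have hw' : w ∈ W := by simpa [hwS] using hw
      simp [hvS, hwS, key v hvS w hw' hvw]
    · have hv' : v ∈ W := by simpa [hvS] using hv
      simp [hvS, hwS, key w hwS v hv' hvw.symm]
    · have hw' : w ∈ W := by simpa [hwS] using hw
      have hv' : v ∈ W := by simpa [hvS] using hv
      have hh := h.lab_adj v hv' w hw' hvw
      have hr := h.parent_root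
      simp only [hvS, hwS, if_false, Option.elim_some, Option.some.injEq]
      grind

open Classical in
/-- Glue two rooted tree-partitions along their root parts. -/
lemma glue {W₁ W₂ R₁ R₂ : Finset V} (h₁ : HasRootedPartition G N W₁ R₁)
    (h₂ : HasRootedPartition G N W₂ R₂) (hN : (R₁ ∪ R₂).card ≤ N)
    (hR₁ : W₁ ∩ W₂ ⊆ R₁) (hR₂ : W₁ ∩ W₂ ⊆ R₂)
    (hadj : ∀ v ∈ W₁, ∀ w ∈ W₂, G.Adj v w → w ∈ W₁ ∨ v ∈ W₂) :
    HasRootedPartition G N (W₁ ∪ W₂) (R₁ ∪ R₂) := by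
  obtain ⟨ι₁, _, p₁, depth₁, r₁, lab₁, h₁⟩ := h₁
  obtain ⟨ι₂, _, p₂, depth₂, r₂, lab₂, h₂⟩ := h₂
  let e : ι₂ → ι₁ ⊕ {i : ι₂ // i ≠ r₂} := fun i => if h : i = r₂ then .inl r₁ else .inr ⟨i, h⟩
  have he_root : e r₂ = .inl r₁ := by simp [e]
  have he_ne : ∀ i (h : i ≠ r₂), e i = .inr ⟨i, h⟩ := fun i h => by simp [e, h]
  let p : ι₁ ⊕ {i : ι₂ // i ≠ r₂} → ι₁ ⊕ {i : ι₂ // i ≠ r₂} :=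
    Sum.elim (fun i => .inl (p₁ i)) fun i => e (p₂ i)
  have hpe : ∀ i, p (e i) = e (p₂ i) := by
    intro i
    by_cases hi : i = r₂
    · simp [hi, he_root, p, h₁.parent_root, h₂.parent_root]
    · simp [he_ne i hi, p]
  have hlab : ∀ v ∈ W₁, v ∈ W₂ → lab₁ v = r₁ ∧ lab₂ v = r₂ := fun v hv hv' =>
    ⟨(h₁.lab_eq_root v hv).2 (hR₁ (by simp [hv, hv'])),
      (h₂.lab_eq_root v hv').2 (hR₂ (by simp [hv, hv']))⟩
  let lab : V → ι₁ ⊕ {i : ι₂ // i ≠ r₂} := fun v => if v ∈ W₁ then .inl (lab₁ v) else e (lab₂ v)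
  have hlab₁ : ∀ v ∈ W₁, lab v = .inl (lab₁ v) := fun v hv => by simp [lab, hv]
  have hlab₂ : ∀ v ∈ W₂, lab v = e (lab₂ v) := by
    intro v hv
    by_cases hv' : v ∈ W₁
    · obtain ⟨h, h'⟩ := hlab v hv' hv
      rw [hlab₁ v hv', h, h', he_root]
    · simp [lab, hv']
  have hroot : ∀ v ∈ W₁ ∪ W₂, lab v = .inl r₁ ↔ v ∈ R₁ ∪ R₂ := by
    intro v hv
    by_cases hv₁ : v ∈ W₁
    · rw [hlab₁ v hv₁, Sum.inl.injEq, h₁.lab_eq_root v hv₁, Finset.mem_union]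
      refine ⟨Or.inl, fun h => h.elim id fun h => hR₁ ?_⟩
      exact Finset.mem_inter.2 ⟨hv₁, h₂.root_subset h⟩
    · have hv₂ : v ∈ W₂ := by simpa [hv₁] using hv
      have hvR : v ∉ R₁ := fun h => hv₁ (h₁.root_subset h)
      rw [hlab₂ v hv₂, Finset.mem_union, or_iff_right hvR, ← h₂.lab_eq_root v hv₂]
      by_cases h : lab₂ v = r₂
      · simp [h, he_root]
      · simp [h, he_ne]
  refine ⟨_, inferInstance, p,
    Sum.elim depth₁ fun i => depth₁ r₁ + 1 + depth₂ i, .inl r₁, lab, ?_⟩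
  constructor
  · simp [p, h₁.parent_root]
  · rintro (i | ⟨i, hi⟩) hne
    · simpa [p] using h₁.depth_parent i (by simpa using hne)
    · have hlt := h₂.depth_parent i hi
      by_cases hp : p₂ i = r₂
      · simp only [p, Sum.elim_inr, hp, he_root, Sum.elim_inl]
        omega
      · simp only [p, Sum.elim_inr, he_ne _ hp]
        omega
  · exact Finset.union_subset_union h₁.root_subset h₂.root_subset
  · exact hroot
  · rintro (i | ⟨i, hi⟩)
    · obtain ⟨v, hv, rfl⟩ := h₁.exists_lab i
      exact ⟨v, by simp [hv], hlab₁ v hv⟩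
    · obtain ⟨v, hv, rfl⟩ := h₂.exists_lab i
      exact ⟨v, by simp [hv], by rw [hlab₂ v hv, he_ne _ hi]⟩
  · intro i F hFW hF
    by_cases hi : i = .inl r₁
    · refine (Finset.card_le_card fun v hv => ?_).trans hN
      exact (hroot v (hFW hv)).1 ((hF v hv).trans hi)
    rcases i with i | ⟨i, hi'⟩
    · have key : ∀ v ∈ F, v ∈ W₁ ∧ lab₁ v = i := by
        intro v hv
        have hl := hF v hv
        by_cases hv₁ : v ∈ W₁
        · exact ⟨hv₁, by simpa [hlab₁ v hv₁] using hl⟩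
        · have hv₂ : v ∈ W₂ := (Finset.mem_union.1 (hFW hv)).resolve_left hv₁
          rw [hlab₂ v hv₂] at hl
          by_cases h : lab₂ v = r₂
          · rw [h, he_root] at hl
            exact absurd hl.symm hi
          · rw [he_ne _ h] at hl
            cases hl
      exact h₁.card_le i F (fun v hv => (key v hv).1) fun v hv => (key v hv).2
    · have key : ∀ v ∈ F, v ∈ W₂ ∧ lab₂ v = i := by
        intro v hv
        have hl := hF v hv
        by_cases hv₁ : v ∈ W₁
        · rw [hlab₁ v hv₁] at hl
          cases hl
        · have hv₂ : v ∈ W₂ := (Finset.mem_union.1 (hFW hv)).resolve_left hv₁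
          rw [hlab₂ v hv₂] at hl
          by_cases h : lab₂ v = r₂
          · rw [h, he_root] at hl
            cases hl
          · rw [he_ne _ h] at hl
            exact ⟨hv₂, congrArg Subtype.val (Sum.inr.inj hl)⟩
      exact h₂.card_le i F (fun v hv => (key v hv).1) fun v hv => (key v hv).2
  · have key₁ : ∀ v ∈ W₁, ∀ w ∈ W₁, G.Adj v w →
        lab v = lab w ∨ p (lab v) = lab w ∨ p (lab w) = lab v := by
      intro v hv w hw hvw
      rw [hlab₁ v hv, hlab₁ w hw]
      simpa [p] using h₁.lab_adj v hv w hw hvw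
    have key₂ : ∀ v ∈ W₂, ∀ w ∈ W₂, G.Adj v w →
        lab v = lab w ∨ p (lab v) = lab w ∨ p (lab w) = lab v := by
      intro v hv w hw hvw
      rw [hlab₂ v hv, hlab₂ w hw, hpe, hpe]
      rcases h₂.lab_adj v hv w hw hvw with h | h | h <;> simp [h]
    intro v hv w hw hvw
    have := hadj v
    have := hadj w
    have := hvw.symm
    simp only [Finset.mem_union] at hv hw
    grind

lemma exists_isTreePartition [Fintype V] {R : Finset V}
    (h : HasRootedPartition G N Finset.univ R) :
    ∃ (ι : Type) (_ : Fintype ι) (T : SimpleGraph ι) (B : ι → Set V),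
      IsTreePartition G T B ∧ ∀ x, (B x).ncard ≤ N := by
  classical
  obtain ⟨ι, hι, p, depth, r, lab, h⟩ := h
  refine ⟨ι, hι, SimpleGraph.fromRel fun i j => p i = j, fun i => {v | lab v = i}, ?_, ?_⟩
  · refine ⟨isTree_fromRel_parent h.depth_parent h.parent_root, fun i => ?_,
      fun v => ⟨lab v, rfl, fun y hy => hy.symm⟩, ?_⟩
    · obtain ⟨v, -, hv⟩ := h.exists_lab i
      exact ⟨v, hv⟩
    · rintro v w x y hvw rfl rfl
      rw [fromRel_adj]
      have := h.lab_adj v (Finset.mem_univ _) w (Finset.mem_univ _) hvw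
      tauto
  · intro i
    rw [Set.ncard_eq_toFinset_card']
    exact h.card_le i _ (Finset.subset_univ _) fun v hv => by simpa using hv

end HasRootedPartition

open Classical in
lemma IsTreeDecomp.exists_hasRootedPartition {V ι : Type} [Fintype V] [Fintype ι]
    {G : SimpleGraph V} {T : SimpleGraph ι} {B : ι → Set V} (h : IsTreeDecomp G T B) {k d : ℕ}
    (hk : 0 < k) (hd : 0 < d) (hB : ∀ x, (B x).ncard ≤ k)
    (hdeg : ∀ v, (G.neighborSet v).ncard ≤ d) (W : Finset V) :
    ∀ S ⊆ W, 4 * k ≤ S.card → S.card ≤ 12 * (k * d) →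
      ∃ R, S ⊆ R ∧ 2 * R.card + 4 * k ≤ 3 * S.card ∧ HasRootedPartition G (24 * (k * d)) W R := by
  induction W using Finset.strongInduction with
  | H W ih =>
  intro S hSW hS₁ hS₂
  have hSne : S.Nonempty := Finset.card_pos.1 (by omega)
  have hkd : k ≤ k * d := Nat.le_mul_of_pos_right k hd
  have hunion : S ∪ W \ S = W := Finset.union_sdiff_of_subset hSW
  by_cases hsmall : (W \ S).card ≤ 24 * (k * d)
  · refine ⟨S, subset_rfl, by omega, ?_⟩
    rcases (W \ S).eq_empty_or_nonempty with he | hne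
    · rw [he, Finset.union_empty] at hunion
      rw [← hunion]
      exact .single hSne (by omega)
    · have := (HasRootedPartition.single (G := G) hne hsmall).cons hSne (by omega)
        Finset.disjoint_sdiff fun _ _ w hw _ => hw
      rwa [hunion] at this
  by_cases hS₃ : S.card ≤ 12 * k
  · set S' := (S.biUnion fun v => (G.neighborSet v).toFinset) ∩ (W \ S) with hS'
    have hc : S'.card ≤ 12 * (k * d) := calc
      S'.card ≤ (S.biUnion fun v => (G.neighborSet v).toFinset).card :=
        Finset.card_le_card Finset.inter_subset_left
      _ ≤ S.card * d := Finset.card_biUnion_le_card_mul _ _ _ fun v _ => by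
        rw [← Set.ncard_eq_toFinset_card']; exact hdeg v
      _ ≤ 12 * k * d := Nat.mul_le_mul_right _ hS₃
      _ = _ := by ring
    obtain ⟨U, hU₁, hU₂, hU₃⟩ := Finset.exists_subsuperset_card_eq
      (s := S') (t := W \ S) (n := max (4 * k) S'.card) Finset.inter_subset_right
      (le_max_right _ _) (by omega)
    obtain ⟨R, hR₁, hR₂, hR₃⟩ := ih (W \ S) (Finset.sdiff_ssubset hSW hSne) U hU₂
      (by omega) (by omega)
    refine ⟨S, subset_rfl, by omega, ?_⟩
    rw [← hunion]
    refine hR₃.cons hSne (by omega) Finset.disjoint_sdiff fun v hv w hw hvw => ?_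
    refine hR₁ (hU₁ ?_)
    rw [hS', Finset.mem_inter, Finset.mem_biUnion]
    exact ⟨⟨v, hv, by simpa using hvw⟩, hw⟩
  · obtain ⟨t, A, hA₁, hA₂, hA₃, hA₄⟩ := h.exists_separation S
    set X := W.filter fun v => v ∈ B t with hX
    set W₁ := W.filter fun v => v ∈ B t ∨ v ∈ A with hW₁
    set W₂ := W.filter fun v => v ∉ A with hW₂
    have hXk : X.card ≤ k := by
      refine le_trans ?_ (hB t)
      rw [← Set.ncard_coe_finset]
      refine Set.ncard_le_ncard ?_ (Set.toFinite _)
      intro v hv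
      exact (Finset.mem_filter.1 (Finset.mem_coe.1 hv)).2
    set S₁ := (S ∩ A) ∪ X with hS₁'
    set S₂ := (S.filter fun v => v ∉ B t ∧ v ∉ A) ∪ X with hS₂'
    have hX₁ : X ⊆ W₁ := by intro v; simp only [hX, hW₁, Finset.mem_filter]; tauto
    have hX₂ : X ⊆ W₂ := by
      intro v; simp only [hX, hW₂, Finset.mem_filter]
      exact fun hv => ⟨hv.1, fun hvA => hA₁ v hvA hv.2⟩
    have hint : W₁ ∩ W₂ = X := by
      apply subset_antisymm
      · intro v; simp only [hX, hW₁, hW₂, Finset.mem_inter, Finset.mem_filter]; tauto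
      · exact Finset.subset_inter hX₁ hX₂
    have hun : W₁ ∪ W₂ = W := by
      ext v; simp only [hW₁, hW₂, Finset.mem_union, Finset.mem_filter]; tauto
    have hs₁ : S₁ ⊆ W₁ := by
      refine Finset.union_subset ?_ hX₁
      intro v hv
      have hv := Finset.mem_inter.1 hv
      exact Finset.mem_filter.2 ⟨hSW hv.1, Or.inr hv.2⟩
    have hs₂ : S₂ ⊆ W₂ := by
      refine Finset.union_subset ?_ hX₂
      intro v hv
      have hv := Finset.mem_filter.1 hv
      exact Finset.mem_filter.2 ⟨hSW hv.1, hv.2.2⟩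
    have hSS₁ : S ⊆ S₁ ∪ (S.filter fun v => v ∉ B t ∧ v ∉ A) := by
      intro v hv
      have := hSW hv
      simp only [hS₁', hX, Finset.mem_union, Finset.mem_inter, Finset.mem_filter]; tauto
    have hSS₂ : S ⊆ S₂ ∪ (S ∩ A) := by
      intro v hv
      have := hSW hv
      simp only [hS₂', hX, Finset.mem_union, Finset.mem_inter, Finset.mem_filter]; tauto
    have c₁ := (Finset.card_le_card hSS₁).trans (Finset.card_union_le _ _)
    have c₂ := (Finset.card_le_card hSS₂).trans (Finset.card_union_le _ _)
    have c₃ : S₁.card ≤ (S ∩ A).card + X.card := Finset.card_union_le _ _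
    have c₄ : S₂.card ≤ (S.filter fun v => v ∉ B t ∧ v ∉ A).card + X.card :=
      Finset.card_union_le _ _
    have c₅ : (S.filter fun v => v ∉ B t ∧ v ∉ A).card + (S ∩ A).card ≤ S.card := by
      rw [← Finset.card_union_of_disjoint]
      · exact Finset.card_le_card (by intro; simp; tauto)
      · rw [Finset.disjoint_left]; intro; simp; tauto
    have hlt₁ : W₁ ⊂ W := by
      rw [Finset.ssubset_iff_of_subset (Finset.filter_subset _ _)]
      obtain ⟨v, hv⟩ : (S.filter fun v => v ∉ B t ∧ v ∉ A).Nonempty :=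
        Finset.card_pos.1 (by omega)
      have hv := Finset.mem_filter.1 hv
      exact ⟨v, hSW hv.1, by simp [hv.2.1, hv.2.2]⟩
    have hlt₂ : W₂ ⊂ W := by
      rw [Finset.ssubset_iff_of_subset (Finset.filter_subset _ _)]
      obtain ⟨v, hv⟩ : (S ∩ A).Nonempty := Finset.card_pos.1 (by omega)
      have hv := Finset.mem_inter.1 hv
      exact ⟨v, hSW hv.1, by simp [hv.2]⟩
    obtain ⟨R₁, hR₁, hcR₁, hp₁⟩ := ih W₁ hlt₁ S₁ hs₁ (by omega) (by omega)
    obtain ⟨R₂, hR₂, hcR₂, hp₂⟩ := ih W₂ hlt₂ S₂ hs₂ (by omega) (by omega)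
    have hXR₁ : X ⊆ R₁ := Finset.subset_union_right.trans hR₁
    have hXR₂ : X ⊆ R₂ := Finset.subset_union_right.trans hR₂
    have c₆ := Finset.card_union_add_card_inter R₁ R₂
    have c₇ := Finset.card_le_card (Finset.subset_inter hXR₁ hXR₂)
    refine ⟨R₁ ∪ R₂, ?_, by omega, ?_⟩
    · intro v hv
      rcases Finset.mem_union.1 (hSS₁ hv) with hv | hv
      · exact Finset.mem_union_left _ (hR₁ hv)
      · exact Finset.mem_union_right _ (hR₂ (Finset.mem_union_left _ hv))
    · rw [← hun]
      refine hp₁.glue hp₂ (by omega) (hint ▸ hXR₁) (hint ▸ hXR₂) ?_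
      intro v hv w hw hvw
      simp only [hW₁, hW₂, Finset.mem_filter] at hv hw ⊢
      by_cases hvA : v ∈ A
      · by_cases hwt : w ∈ B t
        · exact Or.inl ⟨hw.1, Or.inl hwt⟩
        · exact absurd (hA₂ v hvA w hvw hwt) hw.2
      · exact Or.inr ⟨hv.1, hvA⟩

lemma exists_isTreeDecomp_treewidth {V : Type} [Fintype V] (G : SimpleGraph V) :
    ∃ (ι : Type) (_ : Fintype ι) (T : SimpleGraph ι) (B : ι → Set V),
      IsTreeDecomp G T B ∧ ∀ x, (B x).ncard ≤ treewidth G + 1 := by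
  refine Nat.sInf_mem (s := {k | ∃ (ι : Type) (_ : Fintype ι) (T : SimpleGraph ι)
    (B : ι → Set V), IsTreeDecomp G T B ∧ ∀ x, (B x).ncard ≤ k + 1}) ?_
  refine ⟨Nat.card V, Unit, inferInstance, ⊥, fun _ => Set.univ, ?_, ?_⟩
  · refine ⟨IsTree.of_subsingleton, fun u v _ => ⟨(), trivial, trivial⟩, fun v => ?_⟩
    have : Nonempty ({x : Unit | v ∈ (Set.univ : Set V)} : Set Unit) := ⟨⟨(), trivial⟩⟩
    exact IsTree.of_subsingleton.connected
  · intro _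
    rw [Set.ncard_univ]
    omega

lemma ncard_neighborSet_le_maxDeg {V : Type*} [Fintype V] (G : SimpleGraph V) (v : V) :
    (G.neighborSet v).ncard ≤ maxDeg G :=
  le_csSup (Set.finite_range _).bddAbove ⟨v, rfl⟩

/-- For every non-trivial graph `G`,
`tpw(G) ≤ 24·(tw(G)+1)·Δ(G)`. -/
theorem tpw_le_of_nontrivial {V : Type} [Fintype V] (G : SimpleGraph V)
    (hG : G.edgeSet.Nonempty) :
    tpw G ≤ 24 * (treewidth G + 1) * maxDeg G := by
  obtain ⟨u, v, huv⟩ : ∃ u v, G.Adj u v := by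
    obtain ⟨e, he⟩ := hG
    induction e using Sym2.ind with
    | _ u v => exact ⟨u, v, he⟩
  have hd : 0 < maxDeg G := lt_of_lt_of_le
    ((Set.ncard_pos (Set.toFinite _)).2 ⟨v, huv⟩) (ncard_neighborSet_le_maxDeg G u)
  obtain ⟨ι, _, T, B, hTB, hB⟩ := exists_isTreeDecomp_treewidth G
  set k := treewidth G + 1 with hk
  have hkd : k ≤ k * maxDeg G := Nat.le_mul_of_pos_right k hd
  have hpart : ∃ R, HasRootedPartition G (24 * (k * maxDeg G)) Finset.univ R := by
    by_cases hcard : (Finset.univ : Finset V).card ≤ 4 * k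
    · exact ⟨_, .single ⟨u, Finset.mem_univ _⟩ (by omega)⟩
    · obtain ⟨S, -, hS⟩ := Finset.exists_subset_card_eq (not_le.1 hcard).le
      obtain ⟨R, -, -, hR⟩ := hTB.exists_hasRootedPartition (by omega) hd hB
        (ncard_neighborSet_le_maxDeg G) Finset.univ S (Finset.subset_univ _) hS.ge (by omega)
      exact ⟨R, hR⟩
  obtain ⟨R, hR⟩ := hpart
  rw [mul_assoc]
  exact Nat.sInf_le hR.exists_isTreePartition
end

section
/- Fix positive integers k and d. Let G be a graph with tw(G) ≤ k − 1 and Δ(G) ≤ d. For any set S ⊆ V(G) with 4k ≤ |S| ≤ 12kd, there exists a tree-partition (B_x : x ∈ V(T)) of G with width at most 18kd, such that Δ(T) ≤ 6d and there exists a node z ∈ V(T) with: S ⊆ B_z, |B_z| ≤ (3/2)|S| − 2k, and deg_T(z) ≤ |S|/(2k) − 1. -/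
open SimpleGraph

namespace SimpleGraph

/-- The parent relation of a graph `T` with respect to a root `r`: `b` is a neighbour of `a`
that is closer to `r`. -/
def ParentRel {ι : Type*} (T : SimpleGraph ι) (r a b : ι) : Prop :=
  T.Adj a b ∧ T.dist r b < T.dist r a

/-- The set of descendants of a node `x`, including `x` itself. -/
def descendants {ι : Type*} (T : SimpleGraph ι) (r x : ι) : Set ι :=
  {y | Relation.ReflTransGen (T.ParentRel r) y x}

section ParentRel

variable {ι : Type*} {T : SimpleGraph ι} {r : ι}

lemma IsTree.parentRel_or_parentRel (hT : T.IsTree) {a b : ι} (h : T.Adj a b) :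
    T.ParentRel r a b ∨ T.ParentRel r b a :=
  (hT.dist_ne_of_adj r h).lt_or_gt.elim (fun hlt => Or.inr ⟨h.symm, hlt⟩)
    (fun hlt => Or.inl ⟨h, hlt⟩)

lemma IsTree.parentRel_unique (hT : T.IsTree) {a b c : ι}
    (hb : T.ParentRel r a b) (hc : T.ParentRel r a c) : b = c := by
  have key : ∀ {x}, T.ParentRel r a x → ∃ p : T.Walk r a, p.IsPath ∧ p.penultimate = x := by
    intro x hx
    obtain ⟨p, hp⟩ := hT.connected.exists_walk_length_eq_dist r x
    refine ⟨p.concat hx.1.symm, Walk.isPath_of_length_eq_dist _ ?_, by simp⟩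
    have := hT.dist_eq_dist_add_one_of_adj r hx.1
    have := hx.2
    rw [Walk.length_concat]
    omega
  obtain ⟨p, hp, rfl⟩ := key hb
  obtain ⟨q, hq, rfl⟩ := key hc
  rw [(hT.existsUnique_path r a).unique hp hq]

lemma mem_descendants_self (x : ι) : x ∈ T.descendants r x := Relation.ReflTransGen.refl

/-- The only edge leaving the set of descendants of `c` goes from `c` to its parent. -/
lemma IsTree.parentRel_of_adj_of_mem_descendants (hT : T.IsTree) {a b c : ι}
    (h : T.Adj a b) (ha : a ∈ T.descendants r c) (hb : b ∉ T.descendants r c) :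
    T.ParentRel r c b := by
  rcases hT.parentRel_or_parentRel (r := r) h with hab | hba
  · rcases Relation.ReflTransGen.cases_head ha with rfl | ⟨a', haa', ha'⟩
    · exact hab
    · exact absurd (hT.parentRel_unique haa' hab ▸ ha') hb
  · exact absurd (Relation.ReflTransGen.head hba ha) hb

lemma IsTree.mem_descendants_root (hT : T.IsTree) (y : ι) : y ∈ T.descendants r r := by
  by_contra hy
  obtain ⟨p⟩ := hT.connected.preconnected r y
  obtain ⟨d, -, hd₁, hd₂⟩ := p.exists_boundary_dart _ (mem_descendants_self r) hy
  simpa using (hT.parentRel_of_adj_of_mem_descendants d.adj hd₁ hd₂).2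

lemma mem_descendants_iff {x y : ι} :
    y ∈ T.descendants r x ↔ y = x ∨ ∃ c, T.ParentRel r c x ∧ y ∈ T.descendants r c := by
  constructor
  · intro h
    rcases Relation.ReflTransGen.cases_tail h with rfl | ⟨c, hc, hcx⟩
    · exact Or.inl rfl
    · exact Or.inr ⟨c, hcx, hc⟩
  · rintro (rfl | ⟨c, hcx, hc⟩)
    · exact mem_descendants_self _
    · exact Relation.ReflTransGen.tail hc hcx

end ParentRel

end SimpleGraph

/-- If a vertex lies in a bag inside and a bag outside the subtree below `c`, then it lies in the
bag of the parent of `c`. -/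
lemma IsTreeDecomp.mem_bag_parent {V ι : Type*} {G : SimpleGraph V} {T : SimpleGraph ι}
    {B : ι → Set V} (hB : IsTreeDecomp G T B) {r c x y y' : ι} {v : V}
    (hcx : T.ParentRel r c x) (hy : y ∈ T.descendants r c) (hy' : y' ∉ T.descendants r c)
    (hv : v ∈ B y) (hv' : v ∈ B y') : v ∈ B x := by
  obtain ⟨p⟩ := (hB.subtree v).preconnected ⟨y, hv⟩ ⟨y', hv'⟩
  obtain ⟨d, -, hd₁, hd₂⟩ :=
    p.exists_boundary_dart (Subtype.val ⁻¹' T.descendants r c) hy hy'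
  have := hB.isTree.parentRel_of_adj_of_mem_descendants (induce_adj.1 d.adj) hd₁ hd₂
  rw [hB.isTree.parentRel_unique hcx this]
  exact d.snd.2

open Finset in
/-- A balanced separation with respect to a vertex set `S`, found below a deepest node of a
tree-decomposition whose subtree sees at least `4 * k` vertices of `S`. -/
lemma IsTreeDecomp.exists_separation_s6 {V ι : Type*} [Fintype V] [Finite ι] [DecidableEq V]
    {G : SimpleGraph V} {T : SimpleGraph ι} {B : ι → Set V} (hB : IsTreeDecomp G T B) {k : ℕ}
    (hk : 1 ≤ k) (hw : ∀ x, (B x).ncard ≤ k) {S : Finset V} (hS : 12 * k ≤ #S) :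
    ∃ A₁ A₂ : Finset V, #(A₁ ∩ A₂) ≤ k ∧ (∀ v, v ∈ A₁ ∨ v ∈ A₂) ∧
      (∀ v w, G.Adj v w → (v ∈ A₁ ∧ w ∈ A₁) ∨ (v ∈ A₂ ∧ w ∈ A₂)) ∧
      4 * k ≤ #(S ∩ A₁) ∧ 4 * k ≤ #(S ∩ A₂) := by
  classical
  have := Fintype.ofFinite ι
  obtain ⟨r⟩ := hB.isTree.connected.nonempty
  let W : ι → Finset V := fun x => {v | ∃ y ∈ T.descendants r x, v ∈ B y}
  let b : ι → Finset V := fun x => {v | v ∈ B x}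
  have hW : ∀ {x v}, v ∈ W x ↔ ∃ y ∈ T.descendants r x, v ∈ B y := by simp [W]
  have hb : ∀ {x v}, v ∈ b x ↔ v ∈ B x := by simp [b]
  have hbk : ∀ x, #(b x) ≤ k := fun x => by
    rw [← Set.ncard_coe_finset]; simpa [b] using hw x
  have hne : ∀ v, ∃ y, v ∈ B y := fun v => by
    obtain ⟨y, hy⟩ := (hB.subtree v).nonempty
    exact ⟨y, hy⟩
  have hr : r ∈ ({x | 4 * k ≤ #(S ∩ W x)} : Finset ι) := by
    have : S ∩ W r = S := by
      refine inter_eq_left.2 fun v _ => hW.2 ?_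
      obtain ⟨y, hy⟩ := hne v
      exact ⟨y, hB.isTree.mem_descendants_root y, hy⟩
    simp only [mem_filter, mem_univ, true_and, this]
    omega
  obtain ⟨x, hx, hmax⟩ := exists_max_image _ (T.dist r) ⟨r, hr⟩
  simp only [mem_filter, mem_univ, true_and] at hx hmax
  have hchild : ∀ c, T.ParentRel r c x → #(S ∩ W c) < 4 * k := fun c hc => by
    by_contra! h
    exact absurd (hmax c h) (not_le.2 hc.2)
  let A : Finset ι → Finset V := fun C => b x ∪ C.biUnion W
  have hall : ({c | T.ParentRel r c x} : Finset ι) ∈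
      ({C | (∀ c ∈ C, T.ParentRel r c x) ∧ 4 * k ≤ #(S ∩ A C)} : Finset (Finset ι)) := by
    simp only [mem_filter, mem_univ, true_and, imp_self, implies_true]
    refine hx.trans (card_le_card (inter_subset_inter_left ?_))
    intro v hv
    obtain ⟨y, hy, hvy⟩ := hW.1 hv
    rcases mem_descendants_iff.1 hy with rfl | ⟨c, hc, hyc⟩
    · exact mem_union_left _ (hb.2 hvy)
    · exact mem_union_right _ (mem_biUnion.2 ⟨c, by simpa using hc, hW.2 ⟨y, hyc, hvy⟩⟩)
  obtain ⟨C, hC, hmin⟩ := exists_min_image _ card ⟨_, hall⟩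
  simp only [mem_filter, mem_univ, true_and] at hC hmin
  obtain ⟨hCx, hC⟩ := hC
  have hupper : #(S ∩ A C) < 8 * k := by
    obtain rfl | ⟨c, hc⟩ := C.eq_empty_or_nonempty
    · have : #(S ∩ A ∅) ≤ #(b x) := card_le_card (by simp [A])
      have := hbk x
      omega
    · have hlt : #(S ∩ A (C.erase c)) < 4 * k := by
        by_contra! h
        have := hmin _ ⟨fun c' hc' => hCx c' (mem_of_mem_erase hc'), h⟩
        have := card_erase_lt_of_mem hc
        omega
      have hsub : S ∩ A C ⊆ (S ∩ A (C.erase c)) ∪ (S ∩ W c) := by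
        rw [← inter_union_distrib_left]
        refine inter_subset_inter_left ?_
        conv_lhs => rw [← insert_erase hc]
        simp only [A, biUnion_insert]
        intro v
        simp only [mem_union]
        tauto
      have := (card_le_card hsub).trans (card_union_le _ _)
      have := hchild c (hCx c hc)
      omega
  refine ⟨A C, b x ∪ (C.biUnion W)ᶜ, ?_, ?_, ?_, hC, ?_⟩
  · refine (card_le_card fun v hv => ?_).trans (hbk x)
    simp only [A, mem_inter, mem_union, mem_compl] at hv
    tauto
  · intro v
    simp only [A, mem_union, mem_compl]
    tauto
  · intro v w h
    obtain ⟨y, hvy, hwy⟩ := hB.edge_mem h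
    by_cases hy : ∃ c ∈ C, y ∈ T.descendants r c
    · obtain ⟨c, hc, hyc⟩ := hy
      left
      constructor <;> refine mem_union_right _ (mem_biUnion.2 ⟨c, hc, hW.2 ⟨y, hyc, ‹_›⟩⟩)
    · push Not at hy
      have : ∀ u ∈ B y, u ∈ b x ∪ (C.biUnion W)ᶜ := by
        intro u hu
        by_cases huC : u ∈ C.biUnion W
        · obtain ⟨c, hc, huc⟩ := mem_biUnion.1 huC
          obtain ⟨y', hy', huy'⟩ := hW.1 huc
          exact mem_union_left _ (hb.2 (hB.mem_bag_parent (hCx c hc) hy' (hy c hc) huy' hu))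
        · exact mem_union_right _ (mem_compl.2 huC)
      exact Or.inr ⟨this v hvy, this w hwy⟩
  · have hsub : S ⊆ (S ∩ A C) ∪ (S ∩ (b x ∪ (C.biUnion W)ᶜ)) := by
      intro v hv
      simp only [A, mem_union, mem_inter, mem_compl]
      tauto
    have := (card_le_card hsub).trans (card_union_le _ _)
    omega

/-- A partition of `U` indexed by a rooted forest with an additional root `none`, encoded by the
parent function of its remaining nodes. The root part contains `S`, and the parts and the numbers
of children obey bounds depending on `k`, `d` and `S`. -/
structure IsMarkedPartition {V ι : Type*} (G : SimpleGraph V) (k d : ℕ) (U S : Finset V)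
    (node : V → Option ι) (parent : ι → Option ι) (depth : ι → ℕ) : Prop where
  depth_lt : ∀ i j, parent i = some j → depth j < depth i
  exists_node : ∀ i, ∃ v ∈ U, node v = some i
  adj : ∀ v ∈ U, ∀ w ∈ U, G.Adj v w →
    node v = node w ∨ (node v).bind parent = node w ∨ (node w).bind parent = node v
  card_part : ∀ i, {v | v ∈ U ∧ node v = some i}.ncard ≤ 18 * (k * d)
  card_children : ∀ i, {j | parent j = some i}.ncard + 1 ≤ 6 * d
  node_eq_none : ∀ v ∈ S, node v = none
  card_root : 2 * {v | v ∈ U ∧ node v = none}.ncard + 4 * k ≤ 3 * S.card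
  card_root_children : 2 * k * ({j | parent j = none}.ncard + 1) ≤ S.card

section MarkedPartition

open Finset

variable {V : Type*} [DecidableEq V] {G : SimpleGraph V} {k d : ℕ} {U S : Finset V}

/-- The partition of `U` into the parts `S` and `U \ S`. -/
lemma exists_isMarkedPartition_of_card_le [Finite V] (hd : 1 ≤ d) (hSU : S ⊆ U) (hS : 4 * k ≤ #S)
    (hU : #(U \ S) ≤ 18 * (k * d)) :
    ∃ (ι : Type) (_ : Finite ι) (node : V → Option ι) (parent : ι → Option ι) (depth : ι → ℕ),
      IsMarkedPartition G k d U S node parent depth := by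
  classical
  let ι := {_u : Unit // (U \ S).Nonempty}
  have hι : ∀ s : Set ι, s.ncard ≤ 1 := fun s => Set.ncard_le_one_of_subsingleton s
  refine ⟨ι, inferInstance, fun v => if h : v ∈ U \ S then some ⟨(), ⟨v, h⟩⟩ else none,
    fun _ => none, fun _ => 0, by simp, ?_, ?_, ?_, ?_, ?_, ?_, ?_⟩
  · rintro ⟨_, v, hv⟩
    exact ⟨v, (mem_sdiff.1 hv).1, dif_pos hv⟩
  · intro v _ w _ _
    by_cases hv : v ∈ U \ S <;> by_cases hw : w ∈ U \ S <;> simp [hv, hw]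
  · refine fun i => le_trans ?_ hU
    rw [← Set.ncard_coe_finset]
    refine Set.ncard_le_ncard ?_ (Set.toFinite _)
    rintro v ⟨-, hv⟩
    by_contra h
    simp only [mem_coe] at h
    simp [h] at hv
  · intro i
    have := hι {j | none = some i}
    omega
  · intro v hv
    simp [hv]
  · have : {v | v ∈ U ∧ (if h : v ∈ U \ S then some (⟨(), ⟨v, h⟩⟩ : ι) else none) = none} =
        (S : Set V) := by
      ext v
      by_cases hv : v ∈ U \ S
      · simp [(mem_sdiff.1 hv).2]
      · have := @hSU v
        simp only [mem_sdiff] at hv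
        simp only [Set.mem_ofPred_eq, mem_sdiff, hv, dite_false, mem_coe]
        tauto
    rw [this, Set.ncard_coe_finset]
    omega
  · have := hι {j | (none : Option ι) = none}
    calc _ ≤ 2 * k * 2 := by gcongr; omega
      _ ≤ _ := by omega

/-- Adding a new root with part `S` to a partition of `U \ S` whose root part contains
the neighbours of `S`. -/
lemma IsMarkedPartition.addRoot {ι : Type*} [Finite ι] {S' : Finset V} {node : V → Option ι}
    {parent : ι → Option ι} {depth : ι → ℕ}
    (h : IsMarkedPartition G k d (U \ S) S' node parent depth) (hk : 1 ≤ k)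
    (hSU : S ⊆ U) (hS : 4 * k ≤ #S) (hne : S'.Nonempty) (hS'U : S' ⊆ U \ S)
    (hS' : #S' ≤ 12 * (k * d))
    (hadj : ∀ v ∈ S, ∀ w ∈ U \ S, G.Adj v w → w ∈ S') :
    IsMarkedPartition G k d U S (fun v => if v ∈ S then none else some (node v))
      (fun o : Option ι => o.map parent) (fun o => o.elim 0 fun i => depth i + 1) := by
  have hroot : ∀ v ∈ S, ∀ w ∈ U \ S, G.Adj v w → node w = none := fun v hv w hw hvw =>
    h.node_eq_none w (hadj v hv w hw hvw)
  have hpart : ∀ x, {v | v ∈ U ∧ (if v ∈ S then none else some (node v)) = some x} =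
      {v | v ∈ U \ S ∧ node v = x} := by
    intro x
    ext v
    by_cases hv : v ∈ S <;> simp [hv]
  have hchild : ∀ x, {j : Option ι | j.map parent = some x} = some '' {j | parent j = x} := by
    intro x
    ext j
    simp [Option.map_eq_some_iff, and_comm, eq_comm]
  refine ⟨?_, ?_, ?_, ?_, ?_, ?_, ?_, ?_⟩
  · rintro (_ | i) (_ | j) hij
    · simp at hij
    · simp at hij
    · simp
    · simpa using h.depth_lt i j (by simpa using hij)
  · have key : ∀ x, (∃ v ∈ U \ S, node v = x) →
        ∃ v ∈ U, (if v ∈ S then none else some (node v)) = some x := by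
      rintro x ⟨v, hv, hvx⟩
      exact ⟨v, (mem_sdiff.1 hv).1, by simp [(mem_sdiff.1 hv).2, hvx]⟩
    rintro (_ | i)
    · obtain ⟨v, hv⟩ := hne
      exact key none ⟨v, hS'U hv, h.node_eq_none v hv⟩
    · exact key _ (h.exists_node i)
  · intro v hv w hw hvw
    by_cases hvS : v ∈ S <;> by_cases hwS : w ∈ S
    · simp [hvS, hwS]
    · simp [hvS, hwS, hroot v hvS w (mem_sdiff.2 ⟨hw, hwS⟩) hvw]
    · simp [hvS, hwS, hroot w hwS v (mem_sdiff.2 ⟨hv, hvS⟩) hvw.symm]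
    · have := h.adj v (mem_sdiff.2 ⟨hv, hvS⟩) w (mem_sdiff.2 ⟨hw, hwS⟩) hvw
      revert this
      cases node v <;> cases node w <;> simp [hvS, hwS]
  · rintro (_ | i)
    · rw [hpart]
      have := h.card_root
      omega
    · rw [hpart]
      exact h.card_part i
  · rintro (_ | i)
    · rw [hchild, Set.ncard_image_of_injective _ (Option.some_injective _)]
      refine Nat.le_of_mul_le_mul_left (h.card_root_children.trans (hS'.trans ?_))
        (show 0 < 2 * k by omega)
      exact le_of_eq (by ring)
    · rw [hchild, Set.ncard_image_of_injective _ (Option.some_injective _)]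
      exact h.card_children i
  · intro v hv
    simp [hv]
  · have : {v | v ∈ U ∧ (if v ∈ S then none else some (node v)) = none} = (S : Set V) := by
      ext v
      have := @hSU v
      simp only [Set.mem_ofPred_eq, ite_eq_left_iff, reduceCtorEq, imp_false, not_not, mem_coe]
      tauto
    rw [this, Set.ncard_coe_finset]
    omega
  · have : {j : Option ι | j.map parent = none} = {none} := by
      ext; simp
    rw [this, Set.ncard_singleton]
    omega

/-- Gluing two partitions along their roots. -/
lemma IsMarkedPartition.glue [Finite V] {ι₁ ι₂ : Type*} [Finite ι₁] [Finite ι₂]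
    {U₁ U₂ S₁ S₂ : Finset V}
    {node₁ : V → Option ι₁} {parent₁ : ι₁ → Option ι₁} {depth₁ : ι₁ → ℕ}
    {node₂ : V → Option ι₂} {parent₂ : ι₂ → Option ι₂} {depth₂ : ι₂ → ℕ}
    (h₁ : IsMarkedPartition G k d U₁ S₁ node₁ parent₁ depth₁)
    (h₂ : IsMarkedPartition G k d U₂ S₂ node₂ parent₂ depth₂)
    (hX₁ : U₁ ∩ U₂ ⊆ S₁) (hX₂ : U₁ ∩ U₂ ⊆ S₂) (hXk : #(U₁ ∩ U₂) ≤ k)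
    (hS₁ : S ∩ U₁ ⊆ S₁) (hS₂ : S ∩ U₂ ⊆ S₂) (hSU : S ⊆ U₁ ∪ U₂)
    (hcard : #S₁ + #S₂ ≤ #S + 2 * #(U₁ ∩ U₂))
    (hadj : ∀ v ∈ U₁ ∪ U₂, ∀ w ∈ U₁ ∪ U₂, G.Adj v w → (v ∈ U₁ ∧ w ∈ U₁) ∨ (v ∈ U₂ ∧ w ∈ U₂)) :
    IsMarkedPartition G k d (U₁ ∪ U₂) S
      (fun v => if v ∈ U₁ then (node₁ v).map Sum.inl else (node₂ v).map Sum.inr)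
      (Sum.elim (fun i => (parent₁ i).map Sum.inl) (fun i => (parent₂ i).map Sum.inr))
      (Sum.elim depth₁ depth₂) := by
  set node : V → Option (ι₁ ⊕ ι₂) :=
    fun v => if v ∈ U₁ then (node₁ v).map Sum.inl else (node₂ v).map Sum.inr with hnode
  have hn₁ : ∀ v ∈ U₁, node v = (node₁ v).map Sum.inl := fun v hv => if_pos hv
  have hn₂ : ∀ v ∈ U₂, node v = (node₂ v).map Sum.inr := by
    intro v hv
    by_cases hv₁ : v ∈ U₁
    · have hv' := mem_inter.2 ⟨hv₁, hv⟩
      rw [hn₁ v hv₁, h₁.node_eq_none v (hX₁ hv'), h₂.node_eq_none v (hX₂ hv')]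
      rfl
    · exact if_neg hv₁
  have hpart₁ : ∀ i, {v | v ∈ U₁ ∪ U₂ ∧ node v = some (Sum.inl i)} ⊆
      {v | v ∈ U₁ ∧ node₁ v = some i} := by
    rintro i v ⟨hv, hvi⟩
    rcases mem_union.1 hv with hv | hv
    · rw [hn₁ v hv] at hvi
      exact ⟨hv, by simpa using hvi⟩
    · rw [hn₂ v hv] at hvi
      simp at hvi
  have hpart₂ : ∀ i, {v | v ∈ U₁ ∪ U₂ ∧ node v = some (Sum.inr i)} ⊆
      {v | v ∈ U₂ ∧ node₂ v = some i} := by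
    rintro i v ⟨hv, hvi⟩
    rcases mem_union.1 hv with hv | hv
    · rw [hn₁ v hv] at hvi
      simp at hvi
    · rw [hn₂ v hv] at hvi
      exact ⟨hv, by simpa using hvi⟩
  refine ⟨?_, ?_, ?_, ?_, ?_, ?_, ?_, ?_⟩
  · rintro (i | i) (j | j) hij
    · exact h₁.depth_lt i j (by simpa using hij)
    · simp at hij
    · simp at hij
    · exact h₂.depth_lt i j (by simpa using hij)
  · rintro (i | i)
    · obtain ⟨v, hv, hvi⟩ := h₁.exists_node i
      exact ⟨v, mem_union_left _ hv, by simp [hn₁ v hv, hvi]⟩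
    · obtain ⟨v, hv, hvi⟩ := h₂.exists_node i
      exact ⟨v, mem_union_right _ hv, by simp [hn₂ v hv, hvi]⟩
  · intro v hv w hw hvw
    rcases hadj v hv w hw hvw with ⟨hv, hw⟩ | ⟨hv, hw⟩
    · have := h₁.adj v hv w hw hvw
      rw [hn₁ v hv, hn₁ w hw]
      revert this
      cases node₁ v <;> cases node₁ w <;> simp
    · have := h₂.adj v hv w hw hvw
      rw [hn₂ v hv, hn₂ w hw]
      revert this
      cases node₂ v <;> cases node₂ w <;> simp
  · rintro (i | i)
    · exact (Set.ncard_le_ncard (hpart₁ i) (Set.toFinite _)).trans (h₁.card_part i)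
    · exact (Set.ncard_le_ncard (hpart₂ i) (Set.toFinite _)).trans (h₂.card_part i)
  · rintro (i | i)
    · refine le_trans (Nat.succ_le_succ ?_) (h₁.card_children i)
      rw [← Set.ncard_image_of_injective {j | parent₁ j = some i} (Sum.inl_injective (β := ι₂))]
      refine Set.ncard_le_ncard ?_ (Set.toFinite _)
      rintro (j | j) hj
      · exact ⟨j, by simpa using hj, rfl⟩
      · simp at hj
    · refine le_trans (Nat.succ_le_succ ?_) (h₂.card_children i)
      rw [← Set.ncard_image_of_injective {j | parent₂ j = some i} (Sum.inr_injective (α := ι₁))]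
      refine Set.ncard_le_ncard ?_ (Set.toFinite _)
      rintro (j | j) hj
      · simp at hj
      · exact ⟨j, by simpa using hj, rfl⟩
  · intro v hv
    rcases mem_union.1 (hSU hv) with hv' | hv'
    · rw [hn₁ v hv', h₁.node_eq_none v (hS₁ (mem_inter.2 ⟨hv, hv'⟩))]
      rfl
    · rw [hn₂ v hv', h₂.node_eq_none v (hS₂ (mem_inter.2 ⟨hv, hv'⟩))]
      rfl
  · have hsub : {v | v ∈ U₁ ∪ U₂ ∧ node v = none} ⊆
        {v | v ∈ U₁ ∧ node₁ v = none} ∪ {v | v ∈ U₂ ∧ node₂ v = none} := by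
      rintro v ⟨hv, hvn⟩
      rcases mem_union.1 hv with hv | hv
      · rw [hn₁ v hv] at hvn
        exact Or.inl ⟨hv, by simpa using hvn⟩
      · rw [hn₂ v hv] at hvn
        exact Or.inr ⟨hv, by simpa using hvn⟩
    have hinter : ((U₁ ∩ U₂ : Finset V) : Set V) ⊆
        {v | v ∈ U₁ ∧ node₁ v = none} ∩ {v | v ∈ U₂ ∧ node₂ v = none} := fun v hv =>
      ⟨⟨(mem_inter.1 hv).1, h₁.node_eq_none v (hX₁ hv)⟩,
        ⟨(mem_inter.1 hv).2, h₂.node_eq_none v (hX₂ hv)⟩⟩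
    have e₁ := Set.ncard_le_ncard hsub (Set.toFinite _)
    have e₂ := Set.ncard_le_ncard hinter (Set.toFinite _)
    rw [Set.ncard_coe_finset] at e₂
    have e₃ := Set.ncard_union_add_ncard_inter {v | v ∈ U₁ ∧ node₁ v = none}
      {v | v ∈ U₂ ∧ node₂ v = none} (Set.toFinite _) (Set.toFinite _)
    have e₄ := h₁.card_root
    have e₅ := h₂.card_root
    omega
  · set parent : ι₁ ⊕ ι₂ → Option (ι₁ ⊕ ι₂) :=
      Sum.elim (fun i => (parent₁ i).map Sum.inl) (fun i => (parent₂ i).map Sum.inr)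
    have hsub : {j | parent j = none} ⊆
        Sum.inl '' {j | parent₁ j = none} ∪ Sum.inr '' {j | parent₂ j = none} := by
      rintro (j | j) hj
      · exact Or.inl ⟨j, by simpa [parent] using hj, rfl⟩
      · exact Or.inr ⟨j, by simpa [parent] using hj, rfl⟩
    have e₁ := (Set.ncard_le_ncard hsub (Set.toFinite _)).trans (Set.ncard_union_le _ _)
    rw [Set.ncard_image_of_injective _ Sum.inl_injective,
      Set.ncard_image_of_injective _ Sum.inr_injective] at e₁
    have e₂ := h₁.card_root_children
    have e₃ := h₂.card_root_children
    have e₄ := Nat.mul_le_mul_left (2 * k) e₁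
    linarith

/-- The induction behind `exists_treePartition_with_marked_set`, for subsets `U` of the
vertex set. -/
lemma exists_isMarkedPartition [Finite V] (hk : 1 ≤ k) (hd : 1 ≤ d)
    (hdeg : ∀ v, (G.neighborSet v).ncard ≤ d)
    (hsep : ∀ S : Finset V, 12 * k ≤ #S → ∃ A₁ A₂ : Finset V, #(A₁ ∩ A₂) ≤ k ∧
      (∀ v, v ∈ A₁ ∨ v ∈ A₂) ∧
      (∀ v w, G.Adj v w → (v ∈ A₁ ∧ w ∈ A₁) ∨ (v ∈ A₂ ∧ w ∈ A₂)) ∧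
      4 * k ≤ #(S ∩ A₁) ∧ 4 * k ≤ #(S ∩ A₂))
    (U S : Finset V) (hSU : S ⊆ U) (hS : 4 * k ≤ #S) (hS' : #S ≤ 12 * (k * d)) :
    ∃ (ι : Type) (_ : Finite ι) (node : V → Option ι) (parent : ι → Option ι) (depth : ι → ℕ),
      IsMarkedPartition G k d U S node parent depth := by
  classical
  induction U using Finset.strongInduction generalizing S with
  | H U ih =>
  have hkd : k ≤ k * d := Nat.le_mul_of_pos_right k hd
  rcases le_or_gt #(U \ S) (18 * (k * d)) with hU | hU
  · exact exists_isMarkedPartition_of_card_le hd hSU hS hU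
  rcases le_or_gt #S (12 * k) with hS12 | hS12
  · let N : Finset V := {w ∈ U \ S | ∃ v ∈ S, G.Adj v w}
    have hN : #N ≤ 12 * (k * d) := by
      have hsub : N ⊆ S.biUnion fun v => (Set.toFinite (G.neighborSet v)).toFinset := by
        intro w hw
        obtain ⟨-, v, hv, hvw⟩ := mem_filter.1 hw
        exact mem_biUnion.2 ⟨v, hv, by simpa using hvw⟩
      refine (card_le_card hsub).trans ((card_biUnion_le_card_mul _ _ d fun v _ => ?_).trans ?_)
      · rw [← Set.ncard_eq_toFinset_card]
        exact hdeg v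
      · calc #S * d ≤ 12 * k * d := by gcongr
          _ = _ := by ring
    obtain ⟨S', hNS', hS'U, hcard⟩ := exists_subsuperset_card_eq (n := max #N (4 * k))
      (filter_subset _ (U \ S) : N ⊆ U \ S) (le_max_left _ _) (by omega)
    have hlt : U \ S ⊂ U := sdiff_ssubset hSU (card_pos.1 (by omega))
    obtain ⟨ι, _, node, parent, depth, h⟩ := ih _ hlt S' hS'U (by omega) (by omega)
    exact ⟨Option ι, inferInstance, _, _, _, h.addRoot hk hSU hS (card_pos.1 (by omega)) hS'U
      (by omega) fun v hv w hw hvw => hNS' (mem_filter.2 ⟨hw, v, hv, hvw⟩)⟩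
  · obtain ⟨A₁, A₂, hX, hcover, hadj, hA₁, hA₂⟩ := hsep S hS12.le
    have hUA : U ∩ A₁ ∪ U ∩ A₂ = U := by
      ext v
      have := hcover v
      simp only [mem_union, mem_inter]
      tauto
    have hinter : (U ∩ A₁) ∩ (U ∩ A₂) ⊆ A₁ ∩ A₂ :=
      inter_subset_inter inter_subset_right inter_subset_right
    set X := (U ∩ A₁) ∩ (U ∩ A₂) with hXdef
    have hXk : #X ≤ k := (card_le_card hinter).trans hX
    have hc₁ := card_union_add_card_inter (S ∩ A₁) X
    have hc₂ := card_union_add_card_inter (S ∩ A₂) X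
    have hSX₁ : (S ∩ A₁) ∩ X = S ∩ X := by
      ext v
      simp only [hXdef, mem_inter]
      tauto
    have hSX₂ : (S ∩ A₂) ∩ X = S ∩ X := by
      ext v
      simp only [hXdef, mem_inter]
      tauto
    have hSX₃ : (S ∩ A₁) ∩ (S ∩ A₂) = S ∩ X := by
      ext v
      have := @hSU v
      simp only [hXdef, mem_inter]
      tauto
    have hSA : S ∩ A₁ ∪ S ∩ A₂ = S := by
      ext v
      have := hcover v
      simp only [mem_union, mem_inter]
      tauto
    have hc₃ := card_union_add_card_inter (S ∩ A₁) (S ∩ A₂)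
    rw [hSX₁] at hc₁
    rw [hSX₂] at hc₂
    rw [hSX₃, hSA] at hc₃
    have hsum : #(S ∩ A₁ ∪ X) + #(S ∩ A₂ ∪ X) ≤ #S + 2 * #X := by omega
    have h₁ : 4 * k ≤ #(S ∩ A₁ ∪ X) := hA₁.trans (card_le_card subset_union_left)
    have h₂ : 4 * k ≤ #(S ∩ A₂ ∪ X) := hA₂.trans (card_le_card subset_union_left)
    have hssub : ∀ A, #(S ∩ A) < #S → U ∩ A ⊂ U := by
      refine fun A hlt => inter_subset_left.ssubset_of_ne fun hUA => ?_
      rw [inter_eq_left.2 (hSU.trans (inter_eq_left.1 hUA))] at hlt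
      exact hlt.false
    have hlt₁ : #(S ∩ A₁) < #S := by
      have := card_le_card (subset_union_left : S ∩ A₁ ⊆ S ∩ A₁ ∪ X)
      omega
    have hlt₂ : #(S ∩ A₂) < #S := by
      have := card_le_card (subset_union_left : S ∩ A₂ ⊆ S ∩ A₂ ∪ X)
      omega
    obtain ⟨ι₁, _, node₁, parent₁, depth₁, hp₁⟩ := ih _ (hssub A₁ hlt₁) (S ∩ A₁ ∪ X)
      (union_subset (inter_subset_inter_right hSU) inter_subset_left) h₁ (by omega)
    obtain ⟨ι₂, _, node₂, parent₂, depth₂, hp₂⟩ := ih _ (hssub A₂ hlt₂) (S ∩ A₂ ∪ X)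
      (union_subset (inter_subset_inter_right hSU) inter_subset_right) h₂ (by omega)
    have hglue := hp₁.glue (S := S) hp₂ subset_union_right subset_union_right hXk
      (fun v hv => by simp only [mem_union, mem_inter] at hv ⊢; tauto)
      (fun v hv => by simp only [mem_union, mem_inter] at hv ⊢; tauto)
      (hUA.symm ▸ hSU) hsum
      (fun v hv w hw hvw => by
        rw [hUA] at hv hw
        have := hadj v w hvw
        simp only [mem_inter]
        tauto)
    rw [hUA] at hglue
    exact ⟨ι₁ ⊕ ι₂, inferInstance, _, _, _, hglue⟩

end MarkedPartition

/-- The graph joining every element of `ι` to its parent, with an additional root `none`,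
is a tree. -/
lemma isTree_fromRel_bind {ι : Type*} [Finite ι] (parent : ι → Option ι) (depth : ι → ℕ)
    (h : ∀ i j, parent i = some j → depth j < depth i) :
    (SimpleGraph.fromRel fun a b : Option ι => a.bind parent = b).IsTree := by
  set T := SimpleGraph.fromRel fun a b : Option ι => a.bind parent = b with hT
  have hne : ∀ i, some i ≠ parent i := fun i hi => (h i i hi.symm).false
  have hadj : ∀ i, T.Adj (some i) (parent i) := fun i =>
    (SimpleGraph.fromRel_adj _ _ _).2 ⟨hne i, Or.inl rfl⟩
  have hreach : ∀ n i, depth i = n → T.Reachable (some i) none := by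
    intro n
    induction n using Nat.strong_induction_on with
    | _ n ih =>
      rintro i rfl
      refine (hadj i).reachable.trans ?_
      cases hp : parent i with
      | none => rfl
      | some j => exact ih _ (h i j hp) j rfl
  have hconn : T.Connected := by
    have hr : ∀ a, T.Reachable a none := by
      rintro (_ | i)
      · rfl
      · exact hreach _ i rfl
    exact ⟨fun a b => (hr a).trans (hr b).symm⟩
  refine SimpleGraph.isTree_iff_connected_and_card.2
    ⟨hconn, le_antisymm ?_ hconn.card_vert_le_card_edgeSet_add_one⟩
  have hsub : T.edgeSet ⊆ Set.range fun i => s(some i, parent i) := by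
    intro e
    induction e with
    | _ a b =>
      rw [SimpleGraph.mem_edgeSet, hT, SimpleGraph.fromRel_adj]
      rintro ⟨hab, rfl | rfl⟩
      · cases a with
        | none => simp at hab
        | some i => exact ⟨i, rfl⟩
      · cases b with
        | none => simp at hab
        | some i => exact ⟨i, Sym2.eq_swap⟩
  rw [Finite.card_option, Nat.card_coe_set_eq]
  refine Nat.succ_le_succ ((Set.ncard_le_ncard hsub (Set.toFinite _)).trans ?_)
  rw [← Set.image_univ, ← Set.ncard_univ]
  exact Set.ncard_image_le (Set.toFinite _)

/-- Fix positive integers `k` and `d`. Let `G` be a graph with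
`tw(G) ≤ k − 1` and `Δ(G) ≤ d`. For any set `S ⊆ V(G)` with `4k ≤ |S| ≤ 12kd`, there is a
tree-partition `(B x : x ∈ V(T))` of `G` with width at most `18kd`, such that `Δ(T) ≤ 6d`
and there is a node `z ∈ V(T)` with `S ⊆ B z`, `|B z| ≤ (3/2)|S| − 2k` and
`deg_T(z) ≤ |S|/(2k) − 1`. -/
theorem exists_treePartition_with_marked_set (k d : ℕ) (hk : 1 ≤ k) (hd : 1 ≤ d)
    {V : Type} [Fintype V] (G : SimpleGraph V)
    (htw : treewidth G ≤ k - 1) (hΔ : maxDeg G ≤ d)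
    (S : Set V) (hS₁ : 4 * k ≤ S.ncard) (hS₂ : S.ncard ≤ 12 * k * d) :
    ∃ (ι : Type) (_ : Fintype ι) (T : SimpleGraph ι) (B : ι → Set V),
      IsTreePartition G T B ∧
      (∀ x, (B x).ncard ≤ 18 * k * d) ∧
      (∀ x, (T.neighborSet x).ncard ≤ 6 * d) ∧
      ∃ z, S ⊆ B z ∧
        ((B z).ncard : ℝ) ≤ 3 / 2 * S.ncard - 2 * k ∧
        ((T.neighborSet z).ncard : ℝ) ≤ S.ncard / (2 * k) - 1 := by
  classical
  have hdeg : ∀ v, (G.neighborSet v).ncard ≤ d := fun v =>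
    (le_csSup (Set.finite_range _).bddAbove ⟨v, rfl⟩).trans hΔ
  obtain ⟨ι₀, _, T₀, B₀, hB₀, hw⟩ : treewidth G ∈ {k | ∃ (ι : Type) (_ : Fintype ι)
      (T : SimpleGraph ι) (B : ι → Set V), IsTreeDecomp G T B ∧ ∀ x, (B x).ncard ≤ k + 1} := by
    refine Nat.sInf_mem ⟨Nat.card V, Unit, inferInstance, ⊥, fun _ => Set.univ,
      ⟨.of_subsingleton, fun _ _ _ => ⟨(), trivial, trivial⟩, fun v => ?_⟩, fun _ => ?_⟩
    · have : Nonempty {x : Unit | v ∈ Set.univ} := ⟨⟨(), trivial⟩⟩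
      exact (SimpleGraph.IsTree.of_subsingleton).connected
    · rw [Set.ncard_univ]
      exact Nat.le_succ _
  have hsep := fun (S : Finset V) (hS : 12 * k ≤ S.card) =>
    hB₀.exists_separation_s6 hk (fun x => (hw x).trans (by omega)) hS
  rw [Set.ncard_eq_toFinset_card'] at hS₁ hS₂
  obtain ⟨ι, _, node, parent, depth, h⟩ := exists_isMarkedPartition hk hd hdeg hsep
    Finset.univ S.toFinset (Finset.subset_univ _) hS₁ (by rwa [← mul_assoc])
  have hSnode : S ⊆ {v | node v = none} := fun v hv => h.node_eq_none v (by simpa using hv)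
  have hroot := h.card_root
  have hrootc := h.card_root_children
  have hpart := h.card_part
  simp only [Finset.mem_univ, true_and] at hroot hpart
  rw [← Set.ncard_eq_toFinset_card'] at hroot hrootc hS₁ hS₂
  have hdegRoot : ((SimpleGraph.fromRel fun a b : Option ι => a.bind parent = b).neighborSet
      none).ncard ≤ {j | parent j = none}.ncard := by
    rw [← Set.ncard_image_of_injective {j | parent j = none} (Option.some_injective ι)]
    refine Set.ncard_le_ncard ?_ (Set.toFinite _)
    rintro (_ | j) hj
    · simp at hj
    · exact ⟨j, by simpa using hj, rfl⟩
  have hk0 : 0 < 2 * k := by omega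
  refine ⟨Option ι, Fintype.ofFinite _, SimpleGraph.fromRel fun a b => a.bind parent = b,
    fun x => {v | node v = x}, ⟨isTree_fromRel_bind parent depth h.depth_lt, ?_, ?_, ?_⟩,
    ?_, ?_, none, hSnode, ?_, ?_⟩
  · rintro (_ | i)
    · exact (Set.nonempty_of_ncard_ne_zero (by omega)).mono hSnode
    · obtain ⟨v, -, hv⟩ := h.exists_node i
      exact ⟨v, hv⟩
  · exact fun v => ⟨node v, rfl, fun y hy => hy.symm⟩
  · rintro v w _ _ hvw rfl rfl
    rw [SimpleGraph.fromRel_adj]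
    have := h.adj v (Finset.mem_univ _) w (Finset.mem_univ _) hvw
    tauto
  · rintro (_ | i)
    · have : 12 * k * d = 12 * (k * d) := by ring
      have : 18 * k * d = 18 * (k * d) := by ring
      change {v | node v = none}.ncard ≤ _
      omega
    · rw [mul_assoc]
      exact hpart i
  · rintro (_ | i)
    · have : 2 * k * ({j | parent j = none}.ncard + 1) ≤ 2 * k * (6 * d) := by
        refine hrootc.trans (hS₂.trans (le_of_eq (by ring)))
      have := Nat.le_of_mul_le_mul_left this hk0
      omega
    · refine le_trans ?_ (h.card_children i)
      rw [← Set.ncard_image_of_injective {j | parent j = some i} (Option.some_injective ι)]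
      refine le_trans (Set.ncard_le_ncard ?_ (Set.toFinite _)) (Set.ncard_insert_le (parent i) _)
      intro j hj
      rw [SimpleGraph.mem_neighborSet, SimpleGraph.fromRel_adj] at hj
      obtain ⟨-, hj | hj⟩ := hj
      · exact Or.inl hj.symm
      · cases j with
        | none => simp at hj
        | some j => exact Or.inr ⟨j, hj, rfl⟩
  · have : (2 * {v | node v = none}.ncard + 4 * k : ℝ) ≤ 3 * S.ncard := by exact_mod_cast hroot
    linarith
  · have hk0' : (0 : ℝ) < 2 * k := by exact_mod_cast hk0
    rw [le_sub_iff_add_le, le_div_iff₀ hk0', mul_comm]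
    exact_mod_cast (Nat.mul_le_mul_left _ (Nat.succ_le_succ hdegRoot)).trans hrootc
end

section
/- For any integer Δ ≥ 3 there exists a real number α > 0 such that there are infinitely many trees X with maximum degree Δ with the property that for every tree T with maximum degree strictly less than Δ, every T-partition of X has width at least |V(X)|^α. -/
open SimpleGraph

section Sphere

variable {ι : Type*} {T : SimpleGraph ι}

theorem SimpleGraph.Connected.exists_adj_dist_eq (hT : T.Connected) {r x : ι} {k : ℕ}
    (h : T.dist r x = k + 1) : ∃ y, T.Adj y x ∧ T.dist r y = k := by
  obtain ⟨p, hp⟩ := hT.exists_walk_length_eq_dist x r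
  rw [dist_comm, h] at hp
  cases p with
  | nil => simp at hp
  | @cons _ y _ hxy q =>
    refine ⟨y, hxy.symm, ?_⟩
    have h₁ : T.dist y r ≤ k := (dist_le q).trans (by simpa using hp.le)
    have h₂ := hT.dist_triangle (u := r) (v := y) (w := x)
    have h₃ : T.dist y x = 1 := dist_eq_one_iff_adj.mpr hxy.symm
    rw [dist_comm] at h₁
    omega

/-- In a connected graph of maximum degree at most `d`, the sphere of radius `k` has at most
`d * (d - 1) ^ k` vertices. -/
theorem SimpleGraph.Connected.card_sphere_le [Fintype ι] (hT : T.Connected) {d : ℕ} (hd : 2 ≤ d)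
    (hdeg : ∀ x, (T.neighborSet x).ncard ≤ d) (r : ι) (k : ℕ) :
    {x | T.dist r x = k}.ncard ≤ d * (d - 1) ^ k := by
  classical
  induction k with
  | zero =>
    have : {x | T.dist r x = 0} = {r} := by
      ext x
      simp [hT.dist_eq_zero_iff, eq_comm]
    rw [this]
    simp
    omega
  | succ k ih =>
    rcases k with _ | k
    · have : {x | T.dist r x = 0 + 1} = T.neighborSet r := by
        ext x
        simp [dist_eq_one_iff_adj]
      rw [this]
      exact (hdeg r).trans (Nat.le_mul_of_pos_right d (Nat.pow_pos (by omega)))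
    · have hsub : Finset.univ.filter (fun x => T.dist r x = k + 1 + 1) ⊆
          (Finset.univ.filter (fun x => T.dist r x = k + 1)).biUnion fun y =>
            Finset.univ.filter fun x => T.Adj y x ∧ T.dist r x = k + 1 + 1 := by
        intro x hx
        simp only [Finset.mem_filter, Finset.mem_univ, true_and, Finset.mem_biUnion] at hx ⊢
        obtain ⟨y, hy, hd⟩ := hT.exists_adj_dist_eq hx
        exact ⟨y, hd, hy, hx⟩
      have hchild : ∀ y ∈ Finset.univ.filter (fun x => T.dist r x = k + 1),
          (Finset.univ.filter fun x => T.Adj y x ∧ T.dist r x = k + 1 + 1).card ≤ d - 1 := by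
        intro y hy
        obtain ⟨z, hz, hzd⟩ := hT.exists_adj_dist_eq (Finset.mem_filter.mp hy).2
        have hlt : {x | T.Adj y x ∧ T.dist r x = k + 1 + 1}.ncard <
            (T.neighborSet y).ncard := by
          refine Set.ncard_lt_ncard ⟨fun x hx => hx.1, fun h => ?_⟩ (Set.toFinite _)
          have := (h hz.symm).2
          omega
        rw [Set.ncard_eq_toFinset_card', Set.toFinset_ofPred] at hlt
        have := hdeg y
        omega
      rw [Set.ncard_eq_toFinset_card', Set.toFinset_ofPred] at ih ⊢
      calc _ ≤ _ := Finset.card_le_card hsub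
        _ ≤ _ := Finset.card_biUnion_le_card_mul _ _ _ hchild
        _ ≤ d * (d - 1) ^ (k + 1) * (d - 1) := Nat.mul_le_mul_right _ ih
        _ = d * (d - 1) ^ (k + 1 + 1) := by ring

theorem SimpleGraph.Connected.card_dist_le [Fintype ι] (hT : T.Connected) {d : ℕ} (hd : 2 ≤ d)
    (hdeg : ∀ x, (T.neighborSet x).ncard ≤ d) (r : ι) (h : ℕ) :
    (Finset.univ.filter fun x => T.dist r x ≤ h).card ≤ (h + 1) * (d * (d - 1) ^ h) := by
  classical
  have hsub : (Finset.univ.filter fun x => T.dist r x ≤ h) ⊆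
      (Finset.range (h + 1)).biUnion fun k => Finset.univ.filter fun x => T.dist r x = k := by
    intro x hx
    simpa [Nat.lt_succ_iff] using hx
  refine (Finset.card_le_card hsub).trans ((Finset.card_biUnion_le_card_mul _ _
    (d * (d - 1) ^ h) fun k hk => ?_).trans (by simp))
  have hs := hT.card_sphere_le hd hdeg r k
  rw [Set.ncard_eq_toFinset_card', Set.toFinset_ofPred] at hs
  exact hs.trans (Nat.mul_le_mul_left _ (Nat.pow_le_pow_right (by omega)
    (Nat.lt_succ_iff.mp (Finset.mem_range.mp hk))))

end Sphere

/-- The vertices of the complete `d`-ary tree of height `h`: words of length at most `h`. -/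
abbrev AryWord (d h : ℕ) : Type := {l : List (Fin d) // l.length ≤ h}

namespace AryWord

variable {d h : ℕ}

instance : Finite (AryWord d h) := List.finite_length_le (Fin d) h

/-- The empty word. -/
def root : AryWord d h := ⟨[], Nat.zero_le h⟩

/-- The complete `d`-ary tree of height `h`. -/
def tree (d h : ℕ) : SimpleGraph (AryWord d h) where
  Adj u v := ∃ a, u.1 = a :: v.1 ∨ v.1 = a :: u.1
  symm := ⟨fun _ _ ⟨a, ha⟩ => ⟨a, ha.symm⟩⟩
  loopless := ⟨fun u ⟨a, ha⟩ => by
    have := congrArg List.length (ha.elim id id)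
    simp at this⟩

theorem exists_walk_root (v : AryWord d h) :
    ∃ p : (tree d h).Walk root v, p.length = v.1.length := by
  obtain ⟨l, hl⟩ := v
  induction l with
  | nil => exact ⟨.nil, rfl⟩
  | cons a l ih =>
    have hl' : l.length ≤ h := (Nat.le_succ _).trans hl
    obtain ⟨p, hp⟩ := ih hl'
    have hadj : (tree d h).Adj ⟨l, hl'⟩ ⟨a :: l, hl⟩ := ⟨a, .inr rfl⟩
    exact ⟨p.concat hadj, by simp [hp]⟩

theorem tree_connected : (tree d h).Connected := by
  have : Nonempty (AryWord d h) := ⟨root⟩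
  refine ⟨fun u v => ?_⟩
  obtain ⟨p, -⟩ := exists_walk_root u
  obtain ⟨q, -⟩ := exists_walk_root v
  exact p.reachable.symm.trans q.reachable

/-- The word obtained by deleting the first letter. -/
def parent (v : AryWord d h) : AryWord d h :=
  ⟨v.1.tail, (by simp : v.1.tail.length ≤ v.1.length).trans v.2⟩

theorem tree_isTree : (tree d h).IsTree := by
  rw [isTree_iff_connected_and_card]
  refine ⟨tree_connected, le_antisymm ?_ tree_connected.card_vert_le_card_edgeSet_add_one⟩
  have hsub : (tree d h).edgeSet ⊆ (fun v => s(v, parent v)) '' {root}ᶜ := by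
    intro e he
    induction e with
    | _ u v =>
      have key : ∀ (a : Fin d) (u v : AryWord d h), u.1 = a :: v.1 →
          s(u, v) ∈ (fun v => s(v, parent v)) '' {root}ᶜ := by
        intro a u v huv
        refine ⟨u, fun hu => ?_, ?_⟩
        · rw [Set.mem_singleton_iff.mp hu] at huv
          simp [root] at huv
        · have : parent u = v := Subtype.ext (by simp [parent, huv])
          simp [this]
      obtain ⟨a, huv | huv⟩ := he
      · exact key a u v huv
      · exact Sym2.eq_swap ▸ key a v u huv
  have h₁ := (Set.ncard_le_ncard hsub (Set.toFinite _)).trans (Set.ncard_image_le (Set.toFinite _))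
  have h₂ := Set.ncard_add_ncard_compl ({root} : Set (AryWord d h))
  rw [Set.ncard_singleton] at h₂
  rw [Nat.card_coe_set_eq]
  omega

theorem ncard_neighborSet_le (v : AryWord d h) :
    ((tree d h).neighborSet v).ncard ≤ d + 1 := by
  classical
  have hsub : Subtype.val '' (tree d h).neighborSet v ⊆
      insert v.1.tail (Set.range fun a => a :: v.1) := by
    rintro _ ⟨w, ⟨a, hw | hw⟩, rfl⟩
    · exact .inl (by simp [hw])
    · exact .inr ⟨a, hw.symm⟩
  rw [← Set.ncard_image_of_injective _ Subtype.val_injective]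
  refine (Set.ncard_le_ncard hsub (Set.toFinite _)).trans ((Set.ncard_insert_le _ _).trans ?_)
  have := Set.ncard_image_le (f := fun a => a :: v.1) (Set.finite_univ (α := Fin d))
  rw [Set.image_univ, Set.ncard_univ, Nat.card_fin] at this
  omega

theorem exists_ncard_neighborSet_eq (hd : 0 < d) (hh : 2 ≤ h) :
    ∃ v, ((tree d h).neighborSet v).ncard = d + 1 := by
  have : 1 ≤ h := by omega
  refine ⟨⟨[⟨0, hd⟩], by simpa⟩, le_antisymm (ncard_neighborSet_le _) ?_⟩
  set f : Option (Fin d) → AryWord d h := fun o =>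
    o.elim root fun a => ⟨[a, ⟨0, hd⟩], by simpa⟩ with hf
  have hinj : Function.Injective f := by
    rintro (_ | a) (_ | b) hab <;> simp [hf, root] at hab ⊢
    exact hab
  have hsub : Set.range f ⊆ (tree d h).neighborSet ⟨[⟨0, hd⟩], by simpa⟩ := by
    rintro _ ⟨_ | a, rfl⟩
    · exact ⟨⟨0, hd⟩, .inl rfl⟩
    · exact ⟨a, .inr rfl⟩
  refine le_trans ?_ (Set.ncard_le_ncard hsub (Set.toFinite _))
  rw [← Set.image_univ, Set.ncard_image_of_injective _ hinj, Set.ncard_univ]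
  simp

theorem maxDeg_tree [Fintype (AryWord d h)] (hd : 0 < d) (hh : 2 ≤ h) :
    maxDeg (tree d h) = d + 1 := by
  have hle : ∀ m ∈ Set.range fun v => ((tree d h).neighborSet v).ncard, m ≤ d + 1 := by
    rintro _ ⟨v, rfl⟩
    exact ncard_neighborSet_le v
  refine le_antisymm (csSup_le ⟨_, root, rfl⟩ hle) (le_csSup ⟨d + 1, hle⟩ ?_)
  exact exists_ncard_neighborSet_eq hd hh

theorem pow_le_card [Fintype (AryWord d h)] : d ^ h ≤ Fintype.card (AryWord d h) := by
  have hinj : Function.Injective fun f : Fin h → Fin d =>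
      (⟨List.ofFn f, by simp⟩ : AryWord d h) :=
    fun f g hfg => List.ofFn_injective (congrArg Subtype.val hfg)
  simpa using Fintype.card_le_of_injective _ hinj

end AryWord

/-- A walk from `u` to `v` bounds the distance between the parts of a tree-partition containing
`u` and `v`. -/
theorem IsTreePartition.dist_le {V ι : Type*} {X : SimpleGraph V} {T : SimpleGraph ι}
    {B : ι → Set V} (hB : IsTreePartition X T B) {u v : V} (p : X.Walk u v) {x y : ι}
    (hu : u ∈ B x) (hv : v ∈ B y) : T.dist x y ≤ p.length := by
  induction p generalizing x with
  | nil =>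
    obtain rfl := (hB.part_existsUnique _).unique hu hv
    simp
  | @cons u w v huw q ih =>
    obtain ⟨z, hz, -⟩ := hB.part_existsUnique w
    have h₁ := ih hz hv
    have h₂ := hB.isTree.connected.dist_triangle (u := x) (v := z) (w := y)
    have h₃ : T.dist x z ≤ 1 := by
      rcases hB.part_adj huw hu hz with rfl | hxz
      · simp
      · exact (dist_eq_one_iff_adj.mpr hxz).le
    rw [Walk.length_cons]
    omega

/-- If `X` has radius at most `h`, then a tree-partition over a tree of maximum degree at most `d`
has a part containing at least a `1 / ((h + 1) * d * (d - 1) ^ h)` fraction of the vertices. -/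
theorem IsTreePartition.exists_le_ncard {V ι : Type*} [Fintype V] [Fintype ι]
    {X : SimpleGraph V} {T : SimpleGraph ι} {B : ι → Set V} (hB : IsTreePartition X T B)
    {d h : ℕ} (hd : 2 ≤ d) (hdeg : ∀ x, (T.neighborSet x).ncard ≤ d) (r : V)
    (hr : ∀ v, ∃ p : X.Walk r v, p.length ≤ h) {b : ℝ} (hb₀ : 0 ≤ b)
    (hb : ((h + 1) * (d * (d - 1) ^ h) : ℝ) * b ≤ Fintype.card V) :
    ∃ x, b ≤ ((B x).ncard : ℝ) := by
  classical
  choose f hf using fun v => (hB.part_existsUnique v).exists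
  have hmaps : ∀ v ∈ (Finset.univ : Finset V),
      f v ∈ Finset.univ.filter fun x => T.dist (f r) x ≤ h := by
    intro v _
    obtain ⟨p, hp⟩ := hr v
    simpa using (hB.dist_le p (hf r) (hf v)).trans hp
  have hcard : ((Finset.univ.filter fun x => T.dist (f r) x ≤ h).card : ℝ) ≤
      (h + 1) * (d * (d - 1) ^ h) := by
    have := hB.isTree.connected.card_dist_le hd hdeg (f r) h
    have hcast : (((d - 1 : ℕ)) : ℝ) = d - 1 := by
      rw [Nat.cast_sub (by omega), Nat.cast_one]
    rw [← hcast]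
    exact_mod_cast this
  obtain ⟨x, -, hx⟩ := Finset.exists_le_card_fiber_of_nsmul_le_card_of_maps_to hmaps
    ⟨_, hmaps r (Finset.mem_univ r)⟩ (b := b) (by
      rw [nsmul_eq_mul, Finset.card_univ]
      exact (mul_le_mul_of_nonneg_right hcard hb₀).trans hb)
  refine ⟨x, hx.trans ?_⟩
  rw [← Set.ncard_coe_finset]
  refine Nat.cast_le.mpr (Set.ncard_le_ncard (fun v hv => ?_) (Set.toFinite _))
  have : f v = x := by simpa using hv
  exact this ▸ hf v

theorem eventually_ball_bound_le {a b c : ℝ} (ha : 0 < a) (hab : a < b) :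
    ∀ᶠ h : ℕ in Filter.atTop, ((h : ℝ) + 1) * (c * a ^ h) ≤ b ^ h := by
  have hr : 1 < b / a := (one_lt_div ha).mpr hab
  have h₁ := tendsto_pow_const_div_const_pow_of_one_lt 1 hr
  have h₀ := tendsto_pow_const_div_const_pow_of_one_lt 0 hr
  have hlim := (h₁.add h₀).const_mul c
  simp only [add_zero, mul_zero] at hlim
  filter_upwards [hlim.eventually_le_const zero_lt_one] with h hh
  have hpow : 0 < (b / a) ^ h := by positivity
  rw [← add_div, ← mul_div_assoc, div_le_one hpow, div_pow, le_div_iff₀ (by positivity)] at hh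
  calc _ = c * ((h : ℝ) ^ 1 + (h : ℝ) ^ 0) * a ^ h := by ring
    _ ≤ _ := hh

/-- For any integer `Δ ≥ 3` there is a real `α > 0` such that there are
infinitely many trees `X` with maximum degree `Δ` such that for every tree `T` with
maximum degree less than `Δ`, every `T`-partition of `X` has width at least `|V(X)|^α`. -/
theorem exists_trees_forcing_large_width (Δ : ℕ) (hΔ : 3 ≤ Δ) :
    ∃ α : ℝ, 0 < α ∧
      ∀ n : ℕ, ∃ (κ : Type) (_ : Fintype κ) (X : SimpleGraph κ),
        X.IsTree ∧ maxDeg X = Δ ∧ n ≤ Fintype.card κ ∧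
        ∀ (ι : Type) (_ : Fintype ι) (T : SimpleGraph ι) (B : ι → Set κ),
          (∀ x, (T.neighborSet x).ncard < Δ) → IsTreePartition X T B →
          ∃ x, ((Fintype.card κ : ℝ)) ^ α ≤ ((B x).ncard : ℝ) := by
  obtain ⟨d, rfl⟩ : ∃ d, Δ = d + 1 := ⟨Δ - 1, by omega⟩
  have hd : 2 ≤ d := by omega
  have hd' : (2 : ℝ) ≤ d := by exact_mod_cast hd
  have hlog : 0 < Real.log d := Real.log_pos (by linarith)
  set β : ℝ := Real.log (d - 1 / 2) / Real.log d with hβ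
  have hβ₀ : 0 ≤ β := div_nonneg (Real.log_nonneg (by linarith)) hlog.le
  have hβ₁ : β < 1 := (div_lt_one hlog).mpr (Real.log_lt_log (by linarith) (by linarith))
  have hdβ : (d : ℝ) ^ β = d - 1 / 2 := by
    rw [Real.rpow_def_of_pos (by linarith), hβ, mul_div_cancel₀ _ hlog.ne',
      Real.exp_log (by linarith)]
  refine ⟨1 - β, by linarith, fun n => ?_⟩
  have hev := eventually_ball_bound_le (a := (d : ℝ) - 1) (b := (d : ℝ) - 1 / 2) (c := d)
    (by linarith) (by linarith)
  obtain ⟨h, hbound, hh⟩ := (hev.and (Filter.eventually_ge_atTop (max n 2))).exists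
  have hn : n ≤ h := (le_max_left _ _).trans hh
  have hh₂ : 2 ≤ h := (le_max_right _ _).trans hh
  let inst : Fintype (AryWord d h) := Fintype.ofFinite _
  have hcard : d ^ h ≤ Fintype.card (AryWord d h) := AryWord.pow_le_card
  refine ⟨AryWord d h, inst, AryWord.tree d h, AryWord.tree_isTree,
    AryWord.maxDeg_tree (by omega) hh₂,
    hn.trans ((Nat.lt_pow_self (by omega)).le.trans hcard), ?_⟩
  intro ι _ T B hdeg hB
  have hpos : (0 : ℝ) < Fintype.card (AryWord d h) :=
    Nat.cast_pos.mpr (Fintype.card_pos_iff.mpr ⟨AryWord.root⟩)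
  refine hB.exists_le_ncard hd (fun x => Nat.lt_succ_iff.mp (hdeg x)) AryWord.root
    (h := h) (fun v => ?_) (by positivity) ?_
  · obtain ⟨p, hp⟩ := AryWord.exists_walk_root v
    exact ⟨p, hp.trans_le v.2⟩
  · have hball : ((h : ℝ) + 1) * (d * (d - 1) ^ h) ≤ (Fintype.card (AryWord d h) : ℝ) ^ β := by
      calc _ ≤ ((d : ℝ) - 1 / 2) ^ h := hbound
        _ = ((d : ℝ) ^ h) ^ β := by
          rw [← hdβ, ← Real.rpow_natCast, ← Real.rpow_natCast, ← Real.rpow_mul (by positivity),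
            ← Real.rpow_mul (by positivity), mul_comm]
        _ ≤ _ := Real.rpow_le_rpow (by positivity) (by exact_mod_cast hcard) hβ₀
    calc _ ≤ (Fintype.card (AryWord d h) : ℝ) ^ β * (Fintype.card (AryWord d h) : ℝ) ^ (1 - β) :=
          mul_le_mul_of_nonneg_right hball (by positivity)
      _ = _ := by rw [← Real.rpow_add hpos, add_sub_cancel, Real.rpow_one]
end
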